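/- arXiv:2512.13952 — 2 statements merged into one kernel-verified Lean document; each statement's English description precedes it below -/
import Mathlib

section
/- Gradient-of-Laplacian estimate for bicaloric functions (Lemma 2.4, Euclidean case): For every integer n ≥ 1 and every ε ∈ (0,1) there is a constant c = c(n,ε) > 0 with the following property. Let p ∈ ℝⁿ, r > 0, and let u : ℝⁿ × ℝ → ℝ be smooth and satisfy ∂_t u + ΔΔu = 0 on ℝⁿ × [−r⁴, 0]. Then r⁶·∫_{Q_{εr}(p)} |∇Δu|² ≤ c·(∫_{Q_r(p)} u² + r²·∫_{Q_r(p)} |∇u|²). -/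
open Set Metric MeasureTheory

noncomputable section

/-- The Euclidean Laplacian of `f : ℝⁿ → ℝ`. -/
def lapE (n : ℕ) (f : EuclideanSpace ℝ (Fin n) → ℝ) (x : EuclideanSpace ℝ (Fin n)) : ℝ :=
  ∑ i : Fin n, fderiv ℝ (fun y => fderiv ℝ f y (EuclideanSpace.single i 1)) x
    (EuclideanSpace.single i 1)

/-- The squared Hilbert–Schmidt norm of the Hessian of `f : ℝⁿ → ℝ`. -/
def hessNormSq (n : ℕ) (f : EuclideanSpace ℝ (Fin n) → ℝ) (x : EuclideanSpace ℝ (Fin n)) : ℝ :=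
  ∑ i : Fin n, ∑ j : Fin n,
    (fderiv ℝ (fun y => fderiv ℝ f y (EuclideanSpace.single j 1)) x
      (EuclideanSpace.single i 1)) ^ 2

/-- The spatial Laplacian of `u : ℝⁿ × ℝ → ℝ`. -/
def slap (n : ℕ) (u : EuclideanSpace ℝ (Fin n) × ℝ → ℝ) :
    EuclideanSpace ℝ (Fin n) × ℝ → ℝ :=
  fun z => lapE n (fun y => u (y, z.2)) z.1

/-- The time derivative of `u : ℝⁿ × ℝ → ℝ`. -/
def tderiv (n : ℕ) (u : EuclideanSpace ℝ (Fin n) × ℝ → ℝ) :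
    EuclideanSpace ℝ (Fin n) × ℝ → ℝ :=
  fun z => deriv (fun s => u (z.1, s)) z.2

/-- The spatial gradient of `u : ℝⁿ × ℝ → ℝ`. -/
def sgrad (n : ℕ) (u : EuclideanSpace ℝ (Fin n) × ℝ → ℝ) :
    EuclideanSpace ℝ (Fin n) × ℝ → EuclideanSpace ℝ (Fin n) :=
  fun z => gradient (fun y => u (y, z.2)) z.1

/-- The squared Hilbert–Schmidt norm of the spatial Hessian of `u : ℝⁿ × ℝ → ℝ`. -/
def shessNormSq (n : ℕ) (u : EuclideanSpace ℝ (Fin n) × ℝ → ℝ) :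
    EuclideanSpace ℝ (Fin n) × ℝ → ℝ :=
  fun z => hessNormSq n (fun y => u (y, z.2)) z.1

/-- The heat ball `Q_r(p) = B_r(p) × [-r⁴, 0]`. -/
def heatBall (n : ℕ) (p : EuclideanSpace ℝ (Fin n)) (r : ℝ) :
    Set (EuclideanSpace ℝ (Fin n) × ℝ) :=
  Metric.ball p r ×ˢ Set.Icc (-(r ^ 4)) 0

/-- `u` solves the biharmonic heat equation `∂ₜ u + ΔΔ u = 0` on `ℝⁿ × [-r⁴, 0]`. -/
def BicaloricOn (n : ℕ) (u : EuclideanSpace ℝ (Fin n) × ℝ → ℝ) (r : ℝ) : Prop :=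
  ∀ (x : EuclideanSpace ℝ (Fin n)), ∀ t ∈ Set.Icc (-(r ^ 4)) (0 : ℝ),
    tderiv n u (x, t) + slap n (slap n u) (x, t) = 0

/-- `u ∈ 𝒫_{d,d'}(ℝⁿ)`: a smooth ancient solution of the biharmonic heat equation with
`sup_{Q_R(p)} |u| ≤ C (1+R)^d` and `sup_{Q_R(p)} |∇u| ≤ C' (1+R)^{d'}`. -/
def PolyCaloric (n : ℕ) (d d' : ℝ) (u : EuclideanSpace ℝ (Fin n) × ℝ → ℝ) : Prop :=
  ContDiff ℝ (⊤ : ℕ∞) u ∧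
  (∀ (x : EuclideanSpace ℝ (Fin n)), ∀ t ≤ (0 : ℝ),
    tderiv n u (x, t) + slap n (slap n u) (x, t) = 0) ∧
  (∃ C : ℝ, 0 < C ∧ ∀ (p : EuclideanSpace ℝ (Fin n)) (R : ℝ), 0 < R →
    ∀ z ∈ heatBall n p R, |u z| ≤ C * (1 + R) ^ d) ∧
  (∃ C' : ℝ, 0 < C' ∧ ∀ (p : EuclideanSpace ℝ (Fin n)) (R : ℝ), 0 < R →
    ∀ z ∈ heatBall n p R, ‖sgrad n u z‖ ≤ C' * (1 + R) ^ d')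

/-- `u ∈ ℋ_{d,d'}(ℝⁿ)`: a smooth biharmonic function with `sup_{B_R(p)} |u| ≤ C (1+R)^d`
and `sup_{B_R(p)} |∇u| ≤ C' (1+R)^{d'}`. -/
def PolyBiharmonic (n : ℕ) (d d' : ℝ) (u : EuclideanSpace ℝ (Fin n) → ℝ) : Prop :=
  ContDiff ℝ (⊤ : ℕ∞) u ∧
  (∀ x, lapE n (lapE n u) x = 0) ∧
  (∃ C : ℝ, 0 < C ∧ ∀ (p : EuclideanSpace ℝ (Fin n)) (R : ℝ), 0 < R →
    ∀ x ∈ Metric.ball p R, |u x| ≤ C * (1 + R) ^ d) ∧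
  (∃ C' : ℝ, 0 < C' ∧ ∀ (p : EuclideanSpace ℝ (Fin n)) (R : ℝ), 0 < R →
    ∀ x ∈ Metric.ball p R, ‖gradient u x‖ ≤ C' * (1 + R) ^ d')

/-- The set `𝒫_{d,d'}(ℝⁿ)`. -/
def Pset (n : ℕ) (d d' : ℝ) : Set (EuclideanSpace ℝ (Fin n) × ℝ → ℝ) :=
  {u | PolyCaloric n d d' u}

/-- The set `ℋ_{d,d'}(ℝⁿ)`. -/
def Hset (n : ℕ) (d d' : ℝ) : Set (EuclideanSpace ℝ (Fin n) → ℝ) :=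
  {u | PolyBiharmonic n d d' u}

open scoped ContDiff

/-- directional derivative -/
def dd {V : Type*} [NormedAddCommGroup V] [NormedSpace ℝ V] (w : V) (f : V → ℝ) : V → ℝ :=
  fun z => fderiv ℝ f z w

section basic
variable {V : Type*} [NormedAddCommGroup V] [NormedSpace ℝ V]

lemma dd_smooth {w : V} {f : V → ℝ} (hf : ContDiff ℝ ∞ f) : ContDiff ℝ ∞ (dd w f) :=
  (hf.fderiv_right (m := ∞) (by simp)).clm_apply contDiff_const

lemma sm_diff {f : V → ℝ} (hf : ContDiff ℝ ∞ f) : Differentiable ℝ f :=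
  hf.differentiable (by simp)

lemma dd_mul {w : V} {f g : V → ℝ} (hf : ContDiff ℝ ∞ f) (hg : ContDiff ℝ ∞ g) (z : V) :
    dd w (fun y => f y * g y) z = dd w f z * g z + f z * dd w g z := by
  unfold dd
  rw [fderiv_fun_mul (sm_diff hf z) (sm_diff hg z)]
  simp; ring

lemma dd_add {w : V} {f g : V → ℝ} (hf : ContDiff ℝ ∞ f) (hg : ContDiff ℝ ∞ g) (z : V) :
    dd w (fun y => f y + g y) z = dd w f z + dd w g z := by
  unfold dd
  rw [fderiv_fun_add (sm_diff hf z) (sm_diff hg z)]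
  simp

lemma dd_const_mul {w : V} {f : V → ℝ} (c : ℝ) (hf : ContDiff ℝ ∞ f) (z : V) :
    dd w (fun y => c * f y) z = c * dd w f z := by
  unfold dd
  rw [fderiv_const_mul (sm_diff hf z)]
  simp

lemma dd_pow {w : V} {f : V → ℝ} (hf : ContDiff ℝ ∞ f) (m : ℕ) (z : V) :
    dd w (fun y => f y ^ (m + 1)) z = (m + 1) * f z ^ m * dd w f z := by
  unfold dd
  rw [fderiv_fun_pow (m + 1) (sm_diff hf z)]
  simp

lemma dd_sum {ι : Type*} {w : V} {s : Finset ι} {f : ι → V → ℝ}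
    (hf : ∀ i ∈ s, ContDiff ℝ ∞ (f i)) (z : V) :
    dd w (fun y => ∑ i ∈ s, f i y) z = ∑ i ∈ s, dd w (f i) z := by
  unfold dd
  rw [fderiv_fun_sum (fun i hi => sm_diff (hf i hi) z)]
  simp

lemma dd_comm {v w : V} {f : V → ℝ} (hf : ContDiff ℝ ∞ f) :
    dd v (dd w f) = dd w (dd v f) := by
  funext z
  have h1 : ∀ a b : V, dd a (dd b f) z = fderiv ℝ (fderiv ℝ f) z a b := by
    intro a b
    unfold dd
    have : DifferentiableAt ℝ (fderiv ℝ f) z :=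
      ((hf.fderiv_right (m := ∞) (by simp)).differentiable (by simp)) z
    rw [fderiv_clm_apply this (differentiableAt_const b)]
    simp
  rw [h1, h1]
  exact ((hf.of_le (m := 2) (by norm_cast)).contDiffAt.isSymmSndFDerivAt (by simp)) v w

lemma dd_compact {w : V} {f : V → ℝ} (hf : HasCompactSupport f) :
    HasCompactSupport (dd w f) := hf.fderiv_apply (𝕜 := ℝ) w

/-- derivative along an affine line depends only on the values on the slice -/
lemma dd_fst {V' : Type*} [NormedAddCommGroup V'] [NormedSpace ℝ V'] {e : V} {f : V × V' → ℝ}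
    (hf : ContDiff ℝ ∞ f) (x : V) (t : V') :
    dd (e, 0) f (x, t) = fderiv ℝ (fun y => f (y, t)) x e := by
  have h := HasFDerivAt.comp (g := f) (f := fun y => (y, t)) x ((sm_diff hf (x, t)).hasFDerivAt)
    ((hasFDerivAt_id x).prodMk (hasFDerivAt_const t x))
  have h2 := h.fderiv
  change fderiv ℝ (fun y => f (y, t)) x = _ at h2
  rw [h2]; simp [dd]

lemma dd_snd {f : V × ℝ → ℝ}
    (hf : ContDiff ℝ ∞ f) (x : V) (t : ℝ) :
    HasDerivAt (fun s => f (x, s)) (dd (0, 1) f (x, t)) t := by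
  have h := ((sm_diff hf (x, t)).hasFDerivAt).comp_hasDerivAt t
    ((hasDerivAt_const t x).prodMk (hasDerivAt_id t))
  exact h
end basic

abbrev EE (n : ℕ) := EuclideanSpace ℝ (Fin n)

def slab (n : ℕ) (T : ℝ) : Set (EE n × ℝ) := univ ×ˢ Icc (-T) 0

section
variable {n : ℕ}

lemma slab_int {f : EE n × ℝ → ℝ} (hf : Continuous f) (hc : HasCompactSupport f) (T : ℝ) :
    IntegrableOn f (slab n T) := (hf.integrable_of_hasCompactSupport hc).integrableOn

lemma slab_dx {f : EE n × ℝ → ℝ} (hf : ContDiff ℝ ∞ f) (hc : HasCompactSupport f) (T : ℝ)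
    (e : EE n) : ∫ z in slab n T, dd (e, 0) f z = 0 := by
  have hi := slab_int (dd_smooth (w := (e, (0:ℝ))) hf).continuous (dd_compact hc) T
  unfold slab IntegrableOn at *
  rw [Measure.volume_eq_prod] at *
  rw [← Measure.prod_restrict] at *
  rw [integral_prod_symm _ hi]
  apply integral_eq_zero_of_ae
  filter_upwards with t
  simp only [Measure.restrict_univ, Pi.zero_apply]
  simp only [dd_fst hf]
  have hcs : HasCompactSupport (fun y => f (y, t)) :=
    hc.comp_isClosedEmbedding (g := fun y => (y, t))
      (Topology.IsClosedEmbedding.of_continuous_injective_isClosedMap (by fun_prop)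
        (fun a b h => congrArg Prod.fst h)
        (by
          intro s hs
          have : Set.image (fun y : EE n => (y, t)) s = s ×ˢ {t} := by ext ⟨a, b⟩; simp [eq_comm]
          rw [this]; exact hs.prod isClosed_singleton))
  have hs : ContDiff ℝ ∞ (fun y => f (y, t)) := hf.comp (contDiff_id.prodMk contDiff_const)
  have hI : Integrable (fun y => fderiv ℝ (fun y => f (y, t)) y e) (volume : Measure (EE n)) :=
    (dd_smooth (w := e) hs).continuous.integrable_of_hasCompactSupport (dd_compact hcs)
  have := integral_mul_fderiv_eq_neg_fderiv_mul_of_integrable (𝕜 := ℝ) (μ := (volume : Measure (EE n)))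
    (f := fun _ : EE n => (1:ℝ)) (g := fun y => f (y, t)) (v := e)
    (by simp) (by simpa using hI)
    (by simpa using hs.continuous.integrable_of_hasCompactSupport hcs)
    (by fun_prop) (fun x _ => sm_diff hs x)
  simpa using this

lemma slab_dt {f : EE n × ℝ → ℝ} (hf : ContDiff ℝ ∞ f) (hc : HasCompactSupport f) {T : ℝ}
    (hT : 0 ≤ T) (h0 : ∀ x, 0 ≤ f (x, 0)) (h1 : ∀ x, f (x, -T) = 0) :
    0 ≤ ∫ z in slab n T, dd (0, 1) f z := by
  have hi := slab_int (dd_smooth (w := ((0 : EE n), (1:ℝ))) hf).continuous (dd_compact hc) T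
  unfold slab IntegrableOn at *
  rw [Measure.volume_eq_prod] at *
  rw [← Measure.prod_restrict] at *
  rw [integral_prod _ hi]
  apply integral_nonneg
  intro x
  simp only [Pi.zero_apply]
  rw [integral_Icc_eq_integral_Ioc, ← intervalIntegral.integral_of_le (by linarith)]
  rw [intervalIntegral.integral_eq_sub_of_hasDerivAt (f := fun s => f (x, s))]
  · rw [h1]; simpa using h0 x
  · intro t _; exact dd_snd hf x t
  · apply Continuous.intervalIntegrable
    exact (dd_smooth hf).continuous.comp (by fun_prop)
end

section
variable {n : ℕ}

def eb (i : Fin n) : EE n × ℝ := (EuclideanSpace.single i 1, 0)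
def tb : EE n × ℝ := (0, 1)
def LL (f : EE n × ℝ → ℝ) : EE n × ℝ → ℝ := fun z => ∑ i, dd (eb i) (dd (eb i) f) z

lemma LL_smooth {f : EE n × ℝ → ℝ} (hf : ContDiff ℝ ∞ f) : ContDiff ℝ ∞ (LL f) :=
  ContDiff.sum fun _ _ => dd_smooth (dd_smooth hf)

lemma LL_mul {f g : EE n × ℝ → ℝ} (hf : ContDiff ℝ ∞ f) (hg : ContDiff ℝ ∞ g) (z) :
    LL (fun y => f y * g y) z = LL f z * g z + 2 * (∑ i, dd (eb i) f z * dd (eb i) g z)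
      + f z * LL g z := by
  unfold LL
  rw [Finset.sum_mul, Finset.mul_sum, Finset.mul_sum, ← Finset.sum_add_distrib,
    ← Finset.sum_add_distrib]
  refine Finset.sum_congr rfl fun i _ => ?_
  have : dd (eb i) (fun y => f y * g y) = fun z => dd (eb i) f z * g z + f z * dd (eb i) g z := by
    funext z; exact dd_mul hf hg z
  rw [this, dd_add ((dd_smooth hf).mul hg) (hf.mul (dd_smooth hg)), dd_mul (dd_smooth hf) hg,
    dd_mul hf (dd_smooth hg)]
  ring

lemma LL_pow {f : EE n × ℝ → ℝ} (hf : ContDiff ℝ ∞ f) (m : ℕ) (z) :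
    LL (fun y => f y ^ (m + 2)) z = (m + 2) * f z ^ (m + 1) * LL f z
      + (m + 2) * (m + 1) * f z ^ m * ∑ i, dd (eb i) f z ^ 2 := by
  unfold LL
  rw [Finset.mul_sum, Finset.mul_sum, ← Finset.sum_add_distrib]
  refine Finset.sum_congr rfl fun i _ => ?_
  have : dd (eb i) (fun y => f y ^ (m + 2)) =
      fun z => ((m : ℝ) + 2) * (f z ^ (m + 1) * dd (eb i) f z) := by
    funext z; rw [dd_pow hf (m + 1) z]; push_cast; ring
  rw [this, dd_const_mul _ ((hf.pow _).mul (dd_smooth hf)), dd_mul (hf.pow _) (dd_smooth hf),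
    dd_pow hf]
  ring

lemma LL_dd {f : EE n × ℝ → ℝ} (hf : ContDiff ℝ ∞ f) (w) :
    LL (dd w f) = dd w (LL f) := by
  funext z
  unfold LL
  rw [dd_sum (fun i _ => dd_smooth (dd_smooth hf))]
  refine Finset.sum_congr rfl fun i _ => ?_
  rw [dd_comm (v := eb i) (w := w) hf, dd_comm (v := eb i) (w := w) (dd_smooth hf)]

lemma cs_pow {ζ : EE n × ℝ → ℝ} (h : HasCompactSupport ζ) {k : ℕ} (hk : k ≠ 0) :
    HasCompactSupport (fun z => ζ z ^ k) :=
  h.comp_left (g := fun x : ℝ => x ^ k) (by simp [hk])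

lemma energy_alg (k : ℕ) (K s z g v P N V l τ : ℝ) (hz0 : 0 ≤ z) (hz1 : z ≤ 1)
    (hs : 0 ≤ s) (hN0 : 0 ≤ N) (hN : N ≤ K * s) (hV : 0 ≤ V)
    (hP : P ^ 2 ≤ N * V) (hl : |l| ≤ K * s) (hτ : |τ| ≤ K * s ^ 2) (hK : 0 ≤ K) :
    1 / 2 * (((k + 3 : ℕ) : ℝ) + 1) * z ^ (k + 3) * τ * v ^ 2
      - 2 * g * ((((k + 3 : ℕ) : ℝ) + 1) * z ^ (k + 3) * P)
      - g * v * ((((k + 2 : ℕ) : ℝ) + 2) * z ^ (k + 3) * l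
        + (((k + 2 : ℕ) : ℝ) + 2) * (((k + 2 : ℕ) : ℝ) + 1) * z ^ (k + 2) * N)
    ≤ 1 / 2 * (z ^ (k + 4) * g ^ 2) +
      ((k + 4) * K + (k + 4) ^ 4 * K ^ 2) * (s ^ 2 * (z ^ k * v ^ 2))
      + 4 * (k + 4) ^ 2 * K * (s * (z ^ (k + 2) * V)) := by
  have ha : 0 ≤ z ^ k := by positivity
  have hm0 : (0 : ℝ) ≤ (k : ℝ) := by positivity
  push_cast
  rw [pow_add z k 4, pow_add z k 3, pow_add z k 2]
  generalize z ^ k = a at *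
  obtain ⟨m, hm⟩ : ∃ m : ℝ, m = (k : ℝ) + 4 := ⟨_, rfl⟩
  have hm1 : 1 ≤ m := by linarith
  rw [show (k : ℝ) + 3 + 1 = m by linarith, show (k : ℝ) + 2 + 2 = m by linarith,
    show (k : ℝ) + 2 + 1 = m - 1 by linarith, ← hm]
  have hKs : 0 ≤ K * s := by positivity
  have hQ : |m * z * l + m * (m - 1) * N| ≤ m ^ 2 * (K * s) := by
    calc |m * z * l + m * (m - 1) * N| ≤ |m * z * l| + |m * (m - 1) * N| := abs_add_le _ _
      _ = m * (z * |l|) + m * (m - 1) * N := by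
        rw [abs_mul, abs_mul, abs_of_nonneg (by linarith : 0 ≤ m), abs_of_nonneg hz0,
          abs_of_nonneg (mul_nonneg (mul_nonneg (by linarith) (by linarith)) hN0)]
        ring
      _ ≤ m * (1 * (K * s)) + m * (m - 1) * (K * s) := by
        have : 0 ≤ m - 1 := by linarith
        gcongr
      _ = _ := by ring
  have hQ2 : (m * z * l + m * (m - 1) * N) ^ 2 ≤ (m ^ 2 * (K * s)) ^ 2 := by
    rw [← sq_abs]; gcongr
  have h1 : 0 ≤ a * (z ^ 2 * g / 2 + 2 * m * z * P) ^ 2 := by positivity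
  have h2 : 0 ≤ a * (z ^ 2 * g / 2 + v * (m * z * l + m * (m - 1) * N)) ^ 2 := by positivity
  have h3 : 1 / 2 * m * (a * z ^ 3) * τ * v ^ 2 ≤ m * K * (s ^ 2 * (a * v ^ 2)) := by
    have hτ' : z ^ 3 * τ ≤ K * s ^ 2 := by
      calc z ^ 3 * τ ≤ z ^ 3 * |τ| := by gcongr; exact le_abs_self τ
        _ ≤ 1 * (K * s ^ 2) := by gcongr; exact pow_le_one₀ hz0 hz1
        _ = _ := one_mul _
    have : (1 / 2 * m * a * v ^ 2) * (z ^ 3 * τ) ≤ (1 / 2 * m * a * v ^ 2) * (K * s ^ 2) := by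
      gcongr
    have h4 : 0 ≤ (1 / 2 * m * a * v ^ 2) * (K * s ^ 2) := by positivity
    nlinarith
  have h5 : a * z ^ 2 * (4 * m ^ 2 * P ^ 2) ≤ a * z ^ 2 * (4 * m ^ 2 * ((K * s) * V)) := by
    have : P ^ 2 ≤ (K * s) * V := hP.trans (by gcongr)
    gcongr
  have h6 : a * v ^ 2 * (m * z * l + m * (m - 1) * N) ^ 2 ≤ a * v ^ 2 * (m ^ 2 * (K * s)) ^ 2 := by
    gcongr
  linarith

lemma energy {ζ v : EE n × ℝ → ℝ} (hζ : ContDiff ℝ ∞ ζ) (hcs : HasCompactSupport ζ)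
    (h0 : ∀ z, 0 ≤ ζ z) (h1 : ∀ z, ζ z ≤ 1) {T : ℝ} (hT : 0 ≤ T) (hζT : ∀ x, ζ (x, -T) = 0)
    (hv : ContDiff ℝ ∞ v) (heq : ∀ z ∈ slab n T, dd tb v z + LL (LL v) z = 0)
    {K s : ℝ} (hK : 0 ≤ K) (hs : 0 ≤ s)
    (hg : ∀ z, ∑ i, dd (eb i) ζ z ^ 2 ≤ K * s) (hl : ∀ z, |LL ζ z| ≤ K * s)
    (ht : ∀ z, |dd tb ζ z| ≤ K * s ^ 2) {k : ℕ} (hk : k ≠ 0) :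
    ∫ z in slab n T, ζ z ^ (k + 4) * LL v z ^ 2 ≤
      (2 * ((k + 4) * K + (k + 4) ^ 4 * K ^ 2 + 4 * (k + 4) ^ 2 * K)) *
      (s ^ 2 * (∫ z in slab n T, ζ z ^ k * v z ^ 2) +
        s * ∫ z in slab n T, ζ z ^ (k + 2) * ∑ i, dd (eb i) v z ^ 2) := by
  have hW : ContDiff ℝ ∞ (fun z => ζ z ^ (k + 4)) := hζ.pow _
  have hWc : HasCompactSupport (fun z => ζ z ^ (k + 4)) := cs_pow hcs (by simp)
  have hLv := LL_smooth hv
  have hWv : ContDiff ℝ ∞ (fun z => ζ z ^ (k + 4) * v z) := hW.mul hv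
  have hWvc : HasCompactSupport (fun z => ζ z ^ (k + 4) * v z) := hWc.mul_right
  let F : Fin n → EE n × ℝ → ℝ := fun i z => (ζ z ^ (k + 4) * v z) * dd (eb i) (LL v) z
  let G : Fin n → EE n × ℝ → ℝ := fun i z => LL v z * dd (eb i) (fun z => ζ z ^ (k + 4) * v z) z
  let H : EE n × ℝ → ℝ := fun z => ζ z ^ (k + 4) * (v z * v z)
  have hF : ∀ i, ContDiff ℝ ∞ (F i) := fun i => hWv.mul (dd_smooth hLv)
  have hG : ∀ i, ContDiff ℝ ∞ (G i) := fun i => hLv.mul (dd_smooth hWv)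
  have hH : ContDiff ℝ ∞ H := hW.mul (hv.mul hv)
  have hFc : ∀ i, HasCompactSupport (F i) := fun i => hWvc.mul_right
  have hGc : ∀ i, HasCompactSupport (G i) := fun i => (dd_compact hWvc).mul_left
  have hHc : HasCompactSupport H := hWc.mul_right
  have key : ∀ z ∈ slab n T, 1 / 2 * (ζ z ^ (k + 4) * LL v z ^ 2) +
      1 / 2 * dd tb H z + ∑ i, (dd (eb i) (F i) z - dd (eb i) (G i) z) ≤
      ((k + 4) * K + (k + 4) ^ 4 * K ^ 2) * (s ^ 2 * (ζ z ^ k * v z ^ 2))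
      + 4 * (k + 4) ^ 2 * K * (s * (ζ z ^ (k + 2) * ∑ i, dd (eb i) v z ^ 2)) := by
    intro z hz
    have e1 : dd tb H z = dd tb (fun z => ζ z ^ (k + 4)) z * (v z * v z) +
        ζ z ^ (k + 4) * (2 * v z * dd tb v z) := by
      rw [dd_mul hW (hv.mul hv), dd_mul hv hv]; ring
    have e2 : ∑ i, (dd (eb i) (F i) z - dd (eb i) (G i) z) =
        (ζ z ^ (k + 4) * v z) * LL (LL v) z - LL v z * LL (fun z => ζ z ^ (k + 4) * v z) z := by
      have l1 : ∀ f : EE n × ℝ → ℝ, LL f z = ∑ i, dd (eb i) (dd (eb i) f) z := fun f => rfl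
      rw [l1 (LL v), l1 (fun z => ζ z ^ (k + 4) * v z), Finset.mul_sum, Finset.mul_sum,
        ← Finset.sum_sub_distrib]
      refine Finset.sum_congr rfl fun i _ => ?_
      rw [dd_mul hWv (dd_smooth hLv), dd_mul hLv (dd_smooth hWv)]
      ring
    rw [LL_mul hW hv, LL_pow hζ (k + 2)] at e2
    have e3 : ∑ i, dd (eb i) (fun z => ζ z ^ (k + 4)) z * dd (eb i) v z =
        (((k + 3 : ℕ) : ℝ) + 1) * ζ z ^ (k + 3) * ∑ i, dd (eb i) ζ z * dd (eb i) v z := by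
      rw [Finset.mul_sum]
      refine Finset.sum_congr rfl fun i _ => ?_
      rw [dd_pow hζ (k + 3)]; ring
    rw [e3] at e2
    rw [dd_pow hζ (k + 3)] at e1
    have e4 := heq z hz
    have e5 := energy_alg k K s (ζ z) (LL v z) (v z) (∑ i, dd (eb i) ζ z * dd (eb i) v z)
      (∑ i, dd (eb i) ζ z ^ 2) (∑ i, dd (eb i) v z ^ 2) (LL ζ z) (dd tb ζ z) (h0 z) (h1 z) hs
      (Finset.sum_nonneg fun i _ => sq_nonneg _) (hg z) (Finset.sum_nonneg fun i _ => sq_nonneg _)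
      (Finset.sum_mul_sq_le_sq_mul_sq _ _ _) (hl z) (ht z) hK
    have e6 : LL (LL v) z = - dd tb v z := by linarith
    rw [e2, e1, e6]
    linarith
  have cV : Continuous (fun z => ∑ i, dd (eb i) v z ^ 2) :=
    continuous_finsetSum _ fun i _ => (dd_smooth hv).continuous.pow 2
  have i1 : IntegrableOn (fun z => ζ z ^ (k + 4) * LL v z ^ 2) (slab n T) :=
    slab_int (hW.continuous.mul (hLv.continuous.pow 2)) hWc.mul_right T
  have i2 : IntegrableOn (dd tb H) (slab n T) :=
    slab_int (dd_smooth hH).continuous (dd_compact hHc) T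
  have i3 : ∀ i, IntegrableOn (dd (eb i) (F i)) (slab n T) := fun i =>
    slab_int (dd_smooth (hF i)).continuous (dd_compact (hFc i)) T
  have i4 : ∀ i, IntegrableOn (dd (eb i) (G i)) (slab n T) := fun i =>
    slab_int (dd_smooth (hG i)).continuous (dd_compact (hGc i)) T
  have i5 : IntegrableOn (fun z => ζ z ^ k * v z ^ 2) (slab n T) :=
    slab_int ((hζ.continuous.pow k).mul (hv.continuous.pow 2)) (cs_pow hcs hk).mul_right T
  have i6 : IntegrableOn (fun z => ζ z ^ (k + 2) * ∑ i, dd (eb i) v z ^ 2) (slab n T) :=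
    slab_int ((hζ.continuous.pow _).mul cV) (cs_pow hcs (by simp)).mul_right T
  have i34 : IntegrableOn (fun z => ∑ i, (dd (eb i) (F i) z - dd (eb i) (G i) z)) (slab n T) :=
    integrable_finsetSum _ fun i _ => (i3 i).sub (i4 i)
  have hm := setIntegral_mono_on (((i1.const_mul (1/2)).add (i2.const_mul (1/2))).add i34)
    (((i5.const_mul (s^2)).const_mul ((k + 4) * K + (k + 4) ^ 4 * K ^ 2)).add
      ((i6.const_mul s).const_mul (4 * (k + 4) ^ 2 * K)))
    (MeasurableSet.univ.prod measurableSet_Icc) key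
  have z34 : ∫ z in slab n T, ∑ i, (dd (eb i) (F i) z - dd (eb i) (G i) z) = 0 := by
    have i7 : ∀ i, IntegrableOn (fun z => dd (eb i) (F i) z - dd (eb i) (G i) z) (slab n T) :=
      fun i => (i3 i).sub (i4 i)
    rw [integral_finsetSum _ fun i _ => i7 i]
    refine Finset.sum_eq_zero fun i _ => ?_
    rw [integral_sub (i3 i) (i4 i)]
    have a1 := slab_dx (hF i) (hFc i) T (EuclideanSpace.single i 1)
    have a2 := slab_dx (hG i) (hGc i) T (EuclideanSpace.single i 1)
    unfold eb; rw [a1, a2]; simp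
  have z2 : 0 ≤ ∫ z in slab n T, dd tb H z := by
    apply slab_dt hH hHc hT
    · intro x; exact mul_nonneg (pow_nonneg (h0 _) _) (mul_self_nonneg _)
    · intro x; simp [H, hζT]
  rw [integral_add' ((i1.const_mul (1/2)).add (i2.const_mul (1/2))) i34,
    integral_add' (i1.const_mul (1/2)) (i2.const_mul (1/2)),
    integral_add' ((i5.const_mul (s^2)).const_mul ((k + 4) * K + (k + 4) ^ 4 * K ^ 2))
      ((i6.const_mul s).const_mul (4 * (k + 4) ^ 2 * K)), z34] at hm
  simp only [integral_const_mul] at hm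
  have p5 : 0 ≤ ∫ z in slab n T, ζ z ^ k * v z ^ 2 :=
    integral_nonneg fun z => mul_nonneg (pow_nonneg (h0 _) _) (sq_nonneg _)
  have p6 : 0 ≤ ∫ z in slab n T, ζ z ^ (k + 2) * ∑ i, dd (eb i) v z ^ 2 :=
    integral_nonneg fun z => mul_nonneg (pow_nonneg (h0 _) _)
      (Finset.sum_nonneg fun i _ => sq_nonneg _)
  generalize (∫ z in slab n T, ζ z ^ k * v z ^ 2) = A at *
  generalize (∫ z in slab n T, ζ z ^ (k + 2) * ∑ i, dd (eb i) v z ^ 2) = B at *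
  have q1 : 0 ≤ ((k + 4) * K + (k + 4) ^ 4 * K ^ 2) * (s * B) := by positivity
  have q2 : 0 ≤ (4 * (k + 4) ^ 2 * K) * (s ^ 2 * A) := by positivity
  linarith

lemma hess_alg (k : ℕ) {z : ℝ} (hz : 0 ≤ z) (a b c : ℝ) (M : ℝ) :
    - (M * z ^ (k + 1) * a * b * c) ≤ 1 / 2 * (z ^ (k + 2) * c ^ 2) +
      1 / 2 * M ^ 2 * (z ^ k * (a ^ 2 * b ^ 2)) := by
  have : 0 ≤ z ^ k * (z * c + M * a * b) ^ 2 := by positivity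
  rw [pow_add z k 2, pow_add z k 1]
  linarith

lemma hess {ζ u : EE n × ℝ → ℝ} (hζ : ContDiff ℝ ∞ ζ) (hcs : HasCompactSupport ζ)
    (h0 : ∀ z, 0 ≤ ζ z) {T : ℝ}
    (hu : ContDiff ℝ ∞ u) 
    {K s : ℝ} (hg : ∀ z, ∑ i, dd (eb i) ζ z ^ 2 ≤ K * s) {k : ℕ} (hk : k ≠ 0) :
    ∫ z in slab n T, ζ z ^ (k + 2) * ∑ j, ∑ i, dd (eb i) (dd (eb j) u) z ^ 2 ≤
      3 * (∫ z in slab n T, ζ z ^ (k + 2) * LL u z ^ 2) +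
        2 * (k + 2) ^ 2 * K * (s * ∫ z in slab n T, ζ z ^ k * ∑ i, dd (eb i) u z ^ 2) := by
  have hW : ContDiff ℝ ∞ (fun z => ζ z ^ (k + 2)) := hζ.pow _
  have hWc : HasCompactSupport (fun z => ζ z ^ (k + 2)) := cs_pow hcs (by simp)
  have hd : ∀ i, ContDiff ℝ ∞ (dd (eb i) u) := fun i => dd_smooth hu
  have hdd : ∀ i j, ContDiff ℝ ∞ (dd (eb i) (dd (eb j) u)) := fun i j => dd_smooth (hd j)
  let F : Fin n → Fin n → EE n × ℝ → ℝ :=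
    fun j i z => ζ z ^ (k + 2) * (dd (eb j) u z * dd (eb i) (dd (eb j) u) z)
  let G : Fin n → Fin n → EE n × ℝ → ℝ :=
    fun j i z => ζ z ^ (k + 2) * (dd (eb j) u z * dd (eb i) (dd (eb i) u) z)
  have hF : ∀ j i, ContDiff ℝ ∞ (F j i) := fun j i => hW.mul ((hd j).mul (hdd i j))
  have hG : ∀ j i, ContDiff ℝ ∞ (G j i) := fun j i => hW.mul ((hd j).mul (hdd i i))
  have hFc : ∀ j i, HasCompactSupport (F j i) := fun j i => hWc.mul_right
  have hGc : ∀ j i, HasCompactSupport (G j i) := fun j i => hWc.mul_right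
  have key : ∀ z, 1 / 2 * (ζ z ^ (k + 2) * ∑ j, ∑ i, dd (eb i) (dd (eb j) u) z ^ 2) ≤
      3 / 2 * (ζ z ^ (k + 2) * LL u z ^ 2) +
      (k + 2) ^ 2 * K * (s * (ζ z ^ k * ∑ i, dd (eb i) u z ^ 2)) +
      ∑ j, ∑ i, (dd (eb i) (F j i) z - dd (eb j) (G j i) z) := by
    intro z
    have e1 : ∀ j i, dd (eb i) (F j i) z - dd (eb j) (G j i) z =
        ζ z ^ (k + 2) * dd (eb i) (dd (eb j) u) z ^ 2
        + (((k + 1 : ℕ) : ℝ) + 1) * ζ z ^ (k + 1) * dd (eb i) ζ z * dd (eb j) u z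
            * dd (eb i) (dd (eb j) u) z
        - ζ z ^ (k + 2) * (dd (eb j) (dd (eb j) u) z * dd (eb i) (dd (eb i) u) z)
        - (((k + 1 : ℕ) : ℝ) + 1) * ζ z ^ (k + 1) * ((dd (eb j) ζ z * dd (eb j) u z)
            * dd (eb i) (dd (eb i) u) z) := by
      intro j i
      rw [dd_mul hW ((hd j).mul (hdd i j)), dd_mul hW ((hd j).mul (hdd i i)),
        dd_mul (hd j) (hdd i j), dd_mul (hd j) (hdd i i), dd_pow hζ (k + 1), dd_pow hζ (k + 1)]
      have c : dd (eb i) (dd (eb i) (dd (eb j) u)) = dd (eb j) (dd (eb i) (dd (eb i) u)) := by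
        rw [dd_comm (v := eb i) (w := eb j) hu, dd_comm (v := eb i) (w := eb j) (hd i)]
      rw [c]; ring
    have e2 : ∑ j, ∑ i, (dd (eb i) (F j i) z - dd (eb j) (G j i) z) =
        ζ z ^ (k + 2) * (∑ j, ∑ i, dd (eb i) (dd (eb j) u) z ^ 2)
        + (∑ j, ∑ i, (((k + 1 : ℕ) : ℝ) + 1) * ζ z ^ (k + 1) * dd (eb i) ζ z * dd (eb j) u z
            * dd (eb i) (dd (eb j) u) z)
        - ζ z ^ (k + 2) * LL u z ^ 2
        - (((k + 1 : ℕ) : ℝ) + 1) * ζ z ^ (k + 1) * ((∑ j, dd (eb j) ζ z * dd (eb j) u z)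
            * LL u z) := by
      have e3 : LL u z ^ 2 = ∑ j, ∑ i, dd (eb j) (dd (eb j) u) z * dd (eb i) (dd (eb i) u) z := by
        rw [sq, LL, Finset.sum_mul_sum]
      rw [e3, LL, Finset.sum_mul_sum]
      simp only [Finset.mul_sum, ← Finset.sum_add_distrib, ← Finset.sum_sub_distrib]
      exact Finset.sum_congr rfl fun j _ => Finset.sum_congr rfl fun i _ => e1 j i
    have e4 : - (∑ j, ∑ i, (((k + 1 : ℕ) : ℝ) + 1) * ζ z ^ (k + 1) * dd (eb i) ζ z * dd (eb j) u z
            * dd (eb i) (dd (eb j) u) z) ≤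
        1 / 2 * (ζ z ^ (k + 2) * ∑ j, ∑ i, dd (eb i) (dd (eb j) u) z ^ 2) +
        1 / 2 * (((k + 1 : ℕ) : ℝ) + 1) ^ 2 * (ζ z ^ k *
          ((∑ i, dd (eb i) ζ z ^ 2) * ∑ i, dd (eb i) u z ^ 2)) := by
      rw [mul_comm (∑ i, dd (eb i) ζ z ^ 2), Finset.sum_mul_sum]
      simp only [Finset.mul_sum, ← Finset.sum_add_distrib, ← Finset.sum_neg_distrib]
      refine Finset.sum_le_sum fun j _ => Finset.sum_le_sum fun i _ => ?_
      have := hess_alg k (h0 z) (dd (eb i) ζ z) (dd (eb j) u z) (dd (eb i) (dd (eb j) u) z)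
        (((k + 1 : ℕ) : ℝ) + 1)
      linarith
    have e5 := hess_alg k (h0 z) (∑ j, dd (eb j) ζ z * dd (eb j) u z) (-1) (LL u z)
        (((k + 1 : ℕ) : ℝ) + 1)
    have e6 := Finset.sum_mul_sq_le_sq_mul_sq Finset.univ (fun j => dd (eb j) ζ z)
      (fun j => dd (eb j) u z)
    have hV : 0 ≤ ∑ i, dd (eb i) u z ^ 2 := Finset.sum_nonneg fun i _ => sq_nonneg _
    have e7 : (∑ i, dd (eb i) ζ z ^ 2) * (∑ i, dd (eb i) u z ^ 2) ≤
      (K * s) * ∑ i, dd (eb i) u z ^ 2 := mul_le_mul_of_nonneg_right (hg z) hV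
    have hzk : 0 ≤ ζ z ^ k := pow_nonneg (h0 z) k
    have hM : (((k + 1 : ℕ) : ℝ) + 1) = k + 2 := by push_cast; ring
    rw [hM] at e2 e4 e5
    have e8 : 1 / 2 * ((k : ℝ) + 2) ^ 2 * (ζ z ^ k *
        ((∑ j, dd (eb j) ζ z * dd (eb j) u z) ^ 2 * (-1) ^ 2)) ≤
        1 / 2 * ((k : ℝ) + 2) ^ 2 * (ζ z ^ k * ((K * s) * ∑ i, dd (eb i) u z ^ 2)) := by
      have := e6.trans e7
      refine mul_le_mul_of_nonneg_left (mul_le_mul_of_nonneg_left ?_ hzk) (by positivity)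
      simpa using this
    have e9 : 1 / 2 * ((k : ℝ) + 2) ^ 2 * (ζ z ^ k *
        ((∑ i, dd (eb i) ζ z ^ 2) * (∑ i, dd (eb i) u z ^ 2))) ≤
        1 / 2 * ((k : ℝ) + 2) ^ 2 * (ζ z ^ k * ((K * s) * ∑ i, dd (eb i) u z ^ 2)) := by
      gcongr
    rw [e2]
    linarith
  have i1 : IntegrableOn (fun z => ζ z ^ (k + 2) * ∑ j, ∑ i, dd (eb i) (dd (eb j) u) z ^ 2)
      (slab n T) :=
    slab_int (hW.continuous.mul (continuous_finsetSum _ fun j _ =>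
      continuous_finsetSum _ fun i _ => (hdd i j).continuous.pow 2)) hWc.mul_right T
  have i2 : IntegrableOn (fun z => ζ z ^ (k + 2) * LL u z ^ 2) (slab n T) :=
    slab_int (hW.continuous.mul ((LL_smooth hu).continuous.pow 2)) hWc.mul_right T
  have i3 : ∀ j i, IntegrableOn (dd (eb i) (F j i)) (slab n T) := fun j i =>
    slab_int (dd_smooth (hF j i)).continuous (dd_compact (hFc j i)) T
  have i4 : ∀ j i, IntegrableOn (dd (eb j) (G j i)) (slab n T) := fun j i =>
    slab_int (dd_smooth (hG j i)).continuous (dd_compact (hGc j i)) T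
  have i5 : IntegrableOn (fun z => ζ z ^ k * ∑ i, dd (eb i) u z ^ 2) (slab n T) :=
    slab_int ((hζ.continuous.pow k).mul (continuous_finsetSum _ fun i _ =>
      (hd i).continuous.pow 2)) (cs_pow hcs hk).mul_right T
  have i34 : IntegrableOn (fun z => ∑ j, ∑ i, (dd (eb i) (F j i) z - dd (eb j) (G j i) z))
      (slab n T) :=
    integrable_finsetSum _ fun j _ => integrable_finsetSum _ fun i _ => (i3 j i).sub (i4 j i)
  have z34 : ∫ z in slab n T, ∑ j, ∑ i, (dd (eb i) (F j i) z - dd (eb j) (G j i) z) = 0 := by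
    have i7 : ∀ j i, IntegrableOn (fun z => dd (eb i) (F j i) z - dd (eb j) (G j i) z)
      (slab n T) := fun j i => (i3 j i).sub (i4 j i)
    rw [integral_finsetSum _ fun j _ => integrable_finsetSum _ fun i _ => i7 j i]
    refine Finset.sum_eq_zero fun j _ => ?_
    rw [integral_finsetSum _ fun i _ => i7 j i]
    refine Finset.sum_eq_zero fun i _ => ?_
    rw [integral_sub (i3 j i) (i4 j i)]
    have a1 := slab_dx (hF j i) (hFc j i) T (EuclideanSpace.single i 1)
    have a2 := slab_dx (hG j i) (hGc j i) T (EuclideanSpace.single j 1)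
    change ∫ z in slab n T, dd (eb i) (F j i) z = 0 at a1
    change ∫ z in slab n T, dd (eb j) (G j i) z = 0 at a2
    rw [a1, a2]; simp
  have hm := setIntegral_mono_on (i1.const_mul (1/2)) (((i2.const_mul (3/2)).add
    ((i5.const_mul s).const_mul ((k + 2) ^ 2 * K))).add i34)
    (MeasurableSet.univ.prod measurableSet_Icc) (fun z _ => key z)
  rw [integral_add' ((i2.const_mul (3/2)).add ((i5.const_mul s).const_mul ((k + 2) ^ 2 * K))) i34,
    integral_add' (i2.const_mul (3/2)) ((i5.const_mul s).const_mul ((k + 2) ^ 2 * K)), z34] at hm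
  simp only [integral_const_mul] at hm
  linarith
end

section
variable {n : ℕ}

lemma bdd_of {f : EE n × ℝ → ℝ} (hf : Continuous f) (hc : HasCompactSupport f) :
    ∃ C, 0 ≤ C ∧ ∀ z, |f z| ≤ C := by
  obtain ⟨C, hC⟩ := hf.bounded_above_of_compact_support hc
  exact ⟨C, (norm_nonneg _).trans (hC 0), fun z => hC z⟩

def Aff (p : EE n) (r : ℝ) : EE n × ℝ → EE n × ℝ :=
  fun z => (r⁻¹ • (z.1 - p), (r ^ 4)⁻¹ * z.2)

lemma dd_Aff {f : EE n × ℝ → ℝ} (hf : ContDiff ℝ ∞ f) (p : EE n) (r : ℝ) (w z : EE n × ℝ) :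
    dd w (fun y => f (Aff p r y)) z = dd (r⁻¹ • w.1, (r ^ 4)⁻¹ * w.2) f (Aff p r z) := by
  have hA : HasFDerivAt (Aff p r) ((r⁻¹ • ContinuousLinearMap.fst ℝ (EE n) ℝ).prod
      ((r ^ 4)⁻¹ • ContinuousLinearMap.snd ℝ (EE n) ℝ)) z := by
    unfold Aff
    refine HasFDerivAt.prodMk ?_ ?_
    · exact ((hasFDerivAt_fst).sub_const p).const_smul r⁻¹
    · exact (hasFDerivAt_snd (p := z)).const_mul ((r ^ 4)⁻¹)
  have h := HasFDerivAt.comp (g := f) (f := Aff p r) z ((sm_diff hf (Aff p r z)).hasFDerivAt) hA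
  have h2 := h.fderiv
  change fderiv ℝ (fun y => f (Aff p r y)) z = _ at h2
  unfold dd
  rw [h2]; simp

lemma dd_smul {V : Type*} [NormedAddCommGroup V] [NormedSpace ℝ V] (c : ℝ) (w : V) (f : V → ℝ)
    (z : V) : dd (c • w) f z = c * dd w f z := by simp [dd]

lemma dd_Aff_eb {f : EE n × ℝ → ℝ} (hf : ContDiff ℝ ∞ f) (p : EE n) (r : ℝ) (i) (z : EE n × ℝ) :
    dd (eb i) (fun y => f (Aff p r y)) z = r⁻¹ * dd (eb i) f (Aff p r z) := by
  rw [dd_Aff hf, ← dd_smul]; simp [eb]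

lemma dd_Aff_tb {f : EE n × ℝ → ℝ} (hf : ContDiff ℝ ∞ f) (p : EE n) (r : ℝ) (z : EE n × ℝ) :
    dd tb (fun y => f (Aff p r y)) z = (r ^ 4)⁻¹ * dd tb f (Aff p r z) := by
  rw [dd_Aff hf, ← dd_smul]; simp [tb]

lemma Aff_smooth (p : EE n) (r : ℝ) : ContDiff ℝ ∞ (Aff p r) := by
  unfold Aff; fun_prop

lemma LL_Aff {f : EE n × ℝ → ℝ} (hf : ContDiff ℝ ∞ f) (p : EE n) (r : ℝ) (z : EE n × ℝ) :
    LL (fun y => f (Aff p r y)) z = (r ^ 2)⁻¹ * LL f (Aff p r z) := by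
  unfold LL
  rw [Finset.mul_sum]
  refine Finset.sum_congr rfl fun i _ => ?_
  have : dd (eb i) (fun y => f (Aff p r y)) = fun z => r⁻¹ * dd (eb i) f (Aff p r z) :=
    funext fun z => dd_Aff_eb hf p r i z
  have hc : ContDiff ℝ ∞ (fun z => dd (eb i) f (Aff p r z)) :=
    (dd_smooth hf).comp (Aff_smooth p r)
  rw [this, dd_const_mul _ hc, dd_Aff_eb (dd_smooth hf)]
  rw [← mul_assoc, ← mul_inv, ← sq]

lemma cutoff (n : ℕ) (ε : ℝ) (hε : ε ∈ Set.Ioo (0 : ℝ) 1) :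
    ∃ K : ℝ, 0 ≤ K ∧ ∀ (p : EE n) (r : ℝ), 0 < r → ∃ ζ : EE n × ℝ → ℝ,
      ContDiff ℝ ∞ ζ ∧ HasCompactSupport ζ ∧ (∀ z, 0 ≤ ζ z) ∧ (∀ z, ζ z ≤ 1) ∧
      (∀ x, ζ (x, -(r ^ 4)) = 0) ∧ (∀ z, z.1 ∉ ball p r → ζ z = 0) ∧
      (∀ z ∈ heatBall n p (ε * r), ζ z = 1) ∧
      (∀ z, ∑ i, dd (eb i) ζ z ^ 2 ≤ K * (r ^ 2)⁻¹) ∧ (∀ z, |LL ζ z| ≤ K * (r ^ 2)⁻¹) ∧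
      (∀ z, |dd tb ζ z| ≤ K * (r ^ 2)⁻¹ ^ 2) := by
  obtain ⟨he0, he1⟩ := hε
  let η : ContDiffBump (0 : EE n) := ⟨ε, 1, he0, he1⟩
  let θ : ContDiffBump (0 : ℝ) := ⟨ε ^ 4, 1, by positivity, pow_lt_one₀ he0.le he1 (by simp)⟩
  let ζ₀ : EE n × ℝ → ℝ := fun z => η z.1 * θ z.2
  have hs : ContDiff ℝ ∞ ζ₀ := (η.contDiff.comp contDiff_fst).mul (θ.contDiff.comp contDiff_snd)
  have hx : ∀ z : EE n × ℝ, z.1 ∉ ball 0 1 → ζ₀ z = 0 := by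
    intro z hz
    have : η z.1 = 0 := η.zero_of_le_dist (by simpa using hz)
    simp [ζ₀, this]
  have ht : ∀ z : EE n × ℝ, 1 ≤ |z.2| → ζ₀ z = 0 := by
    intro z hz
    have : θ z.2 = 0 := θ.zero_of_le_dist (by simpa using hz)
    simp [ζ₀, this]
  have hc : HasCompactSupport ζ₀ := by
    refine HasCompactSupport.intro ((isCompact_closedBall (0 : EE n) 1).prod
      (isCompact_closedBall (0 : ℝ) 1)) ?_
    intro z hz
    by_cases h : z.1 ∈ ball (0 : EE n) 1
    · apply ht
      by_contra h2
      exact hz ⟨ball_subset_closedBall h, by simpa using (not_le.mp h2).le⟩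
    · exact hx z h
  have hLc : HasCompactSupport (LL ζ₀) := by
    have : ∀ z, LL ζ₀ z = ∑ i, dd (eb i) (dd (eb i) ζ₀) z := fun _ => rfl
    refine HasCompactSupport.intro (K := tsupport ζ₀) hc ?_
    intro z hz
    rw [this]
    refine Finset.sum_eq_zero fun i _ => ?_
    refine image_eq_zero_of_notMem_tsupport fun h => hz ?_
    exact tsupport_fderiv_apply_subset ℝ (eb i) (tsupport_fderiv_apply_subset ℝ (eb i) h)
  have hNc : HasCompactSupport (fun z => ∑ i, dd (eb i) ζ₀ z ^ 2) := by
    refine HasCompactSupport.intro (K := tsupport ζ₀) hc ?_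
    intro z hz
    refine Finset.sum_eq_zero fun i _ => ?_
    have : dd (eb i) ζ₀ z = 0 := image_eq_zero_of_notMem_tsupport fun h => hz
      (tsupport_fderiv_apply_subset ℝ (eb i) h)
    simp [this]
  obtain ⟨K1, hK1, b1⟩ := bdd_of (continuous_finsetSum _ fun i _ =>
    (dd_smooth hs).continuous.pow 2) hNc
  obtain ⟨K2, hK2, b2⟩ := bdd_of (LL_smooth hs).continuous hLc
  obtain ⟨K3, hK3, b3⟩ := bdd_of (dd_smooth (w := tb) hs).continuous (dd_compact hc)
  refine ⟨K1 + K2 + K3, by positivity, fun p r hr => ⟨fun z => ζ₀ (Aff p r z),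
    hs.comp (Aff_smooth p r), ?_, ?_, ?_, ?_, ?_, ?_, ?_, ?_, ?_⟩⟩
  · refine HasCompactSupport.intro (K := closedBall p r ×ˢ closedBall (0 : ℝ) (r ^ 4))
      ((isCompact_closedBall p r).prod (isCompact_closedBall (0 : ℝ) (r ^ 4))) ?_
    intro z hz
    by_contra h
    have h1 : (Aff p r z).1 ∈ ball 0 1 := by by_contra h'; exact h (hx _ h')
    have h2 : |(Aff p r z).2| < 1 := by by_contra h'; exact h (ht _ (not_lt.mp h'))
    refine hz ⟨?_, ?_⟩
    · simp only [Aff, mem_ball_zero_iff, norm_smul, norm_inv, Real.norm_eq_abs, abs_of_pos hr] at h1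
      rw [mem_closedBall, dist_eq_norm]
      rw [inv_mul_lt_iff₀ hr] at h1
      linarith
    · simp only [Aff, abs_mul, abs_inv, abs_of_pos (pow_pos hr 4)] at h2
      rw [inv_mul_lt_iff₀ (by positivity)] at h2
      simp; linarith
  · intro z; exact mul_nonneg η.nonneg θ.nonneg
  · intro z; exact mul_le_one₀ η.le_one θ.nonneg θ.le_one
  · intro x
    apply ht
    simp [Aff, hr.ne']
  · intro z hz
    apply hx
    intro h1
    apply hz
    simp only [Aff, mem_ball_zero_iff, norm_smul, norm_inv, Real.norm_eq_abs, abs_of_pos hr] at h1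
    rw [inv_mul_lt_iff₀ hr] at h1
    rw [mem_ball, dist_eq_norm]
    linarith
  · rintro z ⟨h1, h2⟩
    have a1 : η (Aff p r z).1 = 1 := by
      apply η.one_of_mem_closedBall
      rw [mem_ball, dist_eq_norm] at h1
      simp only [Aff, mem_closedBall_zero_iff, norm_smul, norm_inv, Real.norm_eq_abs,
        abs_of_pos hr]
      rw [inv_mul_le_iff₀ hr]
      change _ ≤ r * ε
      linarith
    have a2 : θ (Aff p r z).2 = 1 := by
      apply θ.one_of_mem_closedBall
      simp only [Aff, mem_closedBall_zero_iff, Real.norm_eq_abs, abs_mul, abs_inv,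
        abs_of_pos (pow_pos hr 4)]
      rw [inv_mul_le_iff₀ (by positivity), abs_of_nonpos h2.2]
      change _ ≤ r ^ 4 * ε ^ 4
      have := h2.1
      rw [mul_pow] at this
      linarith
    simp only [ζ₀, a1, a2, one_mul]
  · intro z
    simp only [dd_Aff_eb hs, mul_pow, ← Finset.mul_sum]
    have := (le_abs_self _).trans (b1 (Aff p r z))
    simp only [Pi.pow_apply] at this
    rw [inv_pow, mul_comm]
    gcongr
    linarith
  · intro z
    rw [LL_Aff hs, abs_mul, abs_of_pos (by positivity), mul_comm]
    gcongr
    linarith [b2 (Aff p r z)]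
  · intro z
    rw [dd_Aff_tb hs, abs_mul, abs_of_pos (by positivity), mul_comm]
    rw [show (r ^ 2)⁻¹ ^ 2 = (r ^ 4)⁻¹ by rw [inv_pow]; ring_nf]
    gcongr
    linarith [b3 (Aff p r z)]

lemma slap_eq {u : EE n × ℝ → ℝ} (hu : ContDiff ℝ ∞ u) : slap n u = LL u := by
  funext ⟨x, t⟩
  unfold slap lapE LL
  refine Finset.sum_congr rfl fun i _ => ?_
  rw [eb, dd_fst (dd_smooth hu)]
  simp only [dd_fst hu]

lemma sgrad_eq {u : EE n × ℝ → ℝ} (hu : ContDiff ℝ ∞ u) (z) :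
    ‖sgrad n u z‖ ^ 2 = ∑ i, dd (eb i) u z ^ 2 := by
  obtain ⟨x, t⟩ := z
  unfold sgrad
  rw [EuclideanSpace.norm_sq_eq]
  refine Finset.sum_congr rfl fun i _ => ?_
  rw [eb, dd_fst hu, Real.norm_eq_abs, sq_abs]
  congr 1
  have : inner ℝ (gradient (fun y => u (y, t)) x) (EuclideanSpace.single i (1 : ℝ)) =
      fderiv ℝ (fun y => u (y, t)) x (EuclideanSpace.single i 1) := by
    simp [gradient]
  rw [← this, EuclideanSpace.inner_single_right]
  simp

lemma tderiv_eq {u : EE n × ℝ → ℝ} (hu : ContDiff ℝ ∞ u) (z) : tderiv n u z = dd tb u z := by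
  obtain ⟨x, t⟩ := z
  exact (dd_snd hu x t).deriv

/-- compare a weighted slab integral with the integral over the heat ball -/
lemma upper {ζ f : EE n × ℝ → ℝ} {p : EE n} {r : ℝ} {k : ℕ} (hk : k ≠ 0) (hζ : Continuous ζ)
    (hcs : HasCompactSupport ζ)
    (h0 : ∀ z, 0 ≤ ζ z) (h1 : ∀ z, ζ z ≤ 1) (hx : ∀ z, z.1 ∉ ball p r → ζ z = 0)
    (hf : Continuous f) (hf0 : ∀ z, 0 ≤ f z) :
    ∫ z in slab n (r ^ 4), ζ z ^ k * f z ≤ ∫ z in heatBall n p r, f z := by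
  have hsub : heatBall n p r ⊆ slab n (r ^ 4) := fun z hz => ⟨mem_univ _, hz.2⟩
  have hm : MeasurableSet (heatBall n p r) := measurableSet_ball.prod measurableSet_Icc
  have hms : MeasurableSet (slab n (r ^ 4)) := MeasurableSet.univ.prod measurableSet_Icc
  have e : ∫ z in slab n (r ^ 4), ζ z ^ k * f z = ∫ z in heatBall n p r, ζ z ^ k * f z := by
    refine (setIntegral_eq_of_subset_of_forall_diff_eq_zero hms hsub ?_)
    rintro z ⟨hz1, hz2⟩
    have : z.1 ∉ ball p r := fun h => hz2 ⟨h, hz1.2⟩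
    simp [hx z this, hk]
  rw [e]
  have hfi : IntegrableOn f (heatBall n p r) :=
    (hf.continuousOn.integrableOn_compact
      ((isCompact_closedBall p r).prod (isCompact_Icc (a := -(r ^ 4)) (b := 0)))).mono_set
      (prod_mono ball_subset_closedBall subset_rfl)
  refine setIntegral_mono_on ((slab_int ((hζ.pow k).mul hf) (cs_pow hcs hk).mul_right _).mono_set
    hsub) hfi hm ?_
  intro z _
  have := pow_le_one₀ (n := k) (h0 z) (h1 z)
  nlinarith [hf0 z]

lemma lower {ζ f : EE n × ℝ → ℝ} {p : EE n} {r ε : ℝ} {k : ℕ} (hk : k ≠ 0) (hζ : Continuous ζ)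
    (hcs : HasCompactSupport ζ) (hr : 0 < r) (he0 : 0 < ε) (he1 : ε < 1)
    (h0 : ∀ z, 0 ≤ ζ z) (hx : ∀ z ∈ heatBall n p (ε * r), ζ z = 1)
    (hf : Continuous f) (hf0 : ∀ z, 0 ≤ f z) :
    ∫ z in heatBall n p (ε * r), f z ≤ ∫ z in slab n (r ^ 4), ζ z ^ k * f z := by
  have hsub : heatBall n p (ε * r) ⊆ slab n (r ^ 4) := by
    intro z hz
    refine ⟨mem_univ _, le_trans ?_ hz.2.1, hz.2.2⟩
    have : (ε * r) ^ 4 ≤ r ^ 4 := by gcongr; nlinarith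
    linarith
  have hm : MeasurableSet (heatBall n p (ε * r)) := measurableSet_ball.prod measurableSet_Icc
  have e : ∫ z in heatBall n p (ε * r), f z = ∫ z in heatBall n p (ε * r), ζ z ^ k * f z := by
    refine setIntegral_congr_fun hm fun z hz => ?_
    simp [hx z hz]
  rw [e]
  refine setIntegral_mono_set (slab_int ((hζ.pow k).mul hf) (cs_pow hcs hk).mul_right _) ?_
    hsub.eventuallyLE
  filter_upwards with z
  exact mul_nonneg (pow_nonneg (h0 z) _) (hf0 z)

end

/-- **Gradient-of-Laplacian estimate for bicaloric functions** (Lemma 2.4, Euclidean case). -/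
theorem grad_laplacian_estimate_bicaloric (n : ℕ) (hn : 1 ≤ n) (ε : ℝ)
    (hε : ε ∈ Set.Ioo (0 : ℝ) 1) :
    ∃ c : ℝ, 0 < c ∧
      ∀ (p : EuclideanSpace ℝ (Fin n)) (r : ℝ), 0 < r →
      ∀ u : EuclideanSpace ℝ (Fin n) × ℝ → ℝ, ContDiff ℝ (⊤ : ℕ∞) u → BicaloricOn n u r →
      r ^ 6 * (∫ z in heatBall n p (ε * r), ‖sgrad n (slap n u) z‖ ^ 2) ≤
      c * ((∫ z in heatBall n p r, (u z) ^ 2) +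
          r ^ 2 * ∫ z in heatBall n p r, ‖sgrad n u z‖ ^ 2) := by
  obtain ⟨K, hK, hcut⟩ := cutoff n ε hε
  obtain ⟨C2, hC2⟩ : ∃ C2 : ℝ, C2 = 2 * ((((2 : ℕ) : ℝ) + 4) * K + (((2 : ℕ) : ℝ) + 4) ^ 4 * K ^ 2
    + 4 * (((2 : ℕ) : ℝ) + 4) ^ 2 * K) := ⟨_, rfl⟩
  obtain ⟨C4, hC4⟩ : ∃ C4 : ℝ, C4 = 2 * ((((4 : ℕ) : ℝ) + 4) * K + (((4 : ℕ) : ℝ) + 4) ^ 4 * K ^ 2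
    + 4 * (((4 : ℕ) : ℝ) + 4) ^ 2 * K) := ⟨_, rfl⟩
  have hC20 : 0 ≤ C2 := by rw [hC2]; positivity
  have hC40 : 0 ≤ C4 := by rw [hC4]; positivity
  refine ⟨C4 * (1 + 3 * C2 + 72 * K) + 1, by positivity, ?_⟩
  intro p r hr u hu hb
  obtain ⟨ζ, hζ, hcs, h0, h1, hζT, hx, hone, hN, hl, ht⟩ := hcut p r hr
  have hLu := LL_smooth hu
  have hbu : ∀ z ∈ slab n (r ^ 4), dd tb u z + LL (LL u) z = 0 := by
    rintro ⟨x, t⟩ hz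
    have := hb x t hz.2
    rwa [tderiv_eq hu, slap_eq hu, slap_eq hLu] at this
  have hbj : ∀ j : Fin n, ∀ z ∈ slab n (r ^ 4),
      dd tb (dd (eb j) u) z + LL (LL (dd (eb j) u)) z = 0 := by
    rintro j ⟨x, t⟩ hz
    rw [LL_dd hu, LL_dd hLu, dd_comm (v := tb) (w := eb j) hu,
      ← dd_add (dd_smooth hu) (LL_smooth hLu), eb,
      dd_fst ((dd_smooth hu).add (LL_smooth hLu))]
    have : (fun y : EE n => dd tb u (y, t) + LL (LL u) (y, t)) = fun _ => 0 :=
      funext fun y => hbu (y, t) ⟨mem_univ _, hz.2⟩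
    rw [this]; simp
  have hs : 0 ≤ (r ^ 2)⁻¹ := by positivity
  have hT : 0 ≤ r ^ 4 := by positivity
  have E1 := energy hζ hcs h0 h1 hT hζT hu hbu hK hs hN hl ht (k := 2) (by simp)
  have E2 := fun j => energy hζ hcs h0 h1 hT hζT (dd_smooth (w := eb j) hu) (hbj j) hK hs hN hl ht
    (k := 4) (by simp)
  have E3 := hess hζ hcs h0 (T := r ^ 4) hu hN (k := 4) (by simp)
  rw [← hC2] at E1
  simp only [← hC4] at E2
  have hd : ∀ i, Continuous (dd (eb i) u) := fun i => (dd_smooth hu).continuous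
  have hdd : ∀ i j, Continuous (dd (eb i) (dd (eb j) u)) :=
    fun i j => (dd_smooth (dd_smooth hu)).continuous
  have hdL : ∀ i, Continuous (dd (eb i) (LL u)) := fun i => (dd_smooth hLu).continuous
  have S1 : ∫ z in slab n (r ^ 4), ζ z ^ 8 * ∑ j, dd (eb j) (LL u) z ^ 2 =
      ∑ j, ∫ z in slab n (r ^ 4), ζ z ^ (4 + 4) * LL (dd (eb j) u) z ^ 2 := by
    rw [← integral_finsetSum]
    · simp only [LL_dd hu, Finset.mul_sum]
    · intro j _
      rw [LL_dd hu]
      exact slab_int ((hζ.continuous.pow _).mul ((hdL j).pow 2)) (cs_pow hcs (by simp)).mul_right _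
  have S2 : ∫ z in slab n (r ^ 4), ζ z ^ 4 * ∑ j, dd (eb j) u z ^ 2 =
      ∑ j, ∫ z in slab n (r ^ 4), ζ z ^ 4 * dd (eb j) u z ^ 2 := by
    rw [← integral_finsetSum]
    · simp only [Finset.mul_sum]
    · intro j _
      exact slab_int ((hζ.continuous.pow _).mul ((hd j).pow 2)) (cs_pow hcs (by simp)).mul_right _
  have S3 : ∫ z in slab n (r ^ 4), ζ z ^ (4 + 2) * ∑ j, ∑ i, dd (eb i) (dd (eb j) u) z ^ 2 =
      ∑ j, ∫ z in slab n (r ^ 4), ζ z ^ (4 + 2) * ∑ i, dd (eb i) (dd (eb j) u) z ^ 2 := by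
    rw [← integral_finsetSum]
    · simp only [Finset.mul_sum]
    · intro j _
      exact slab_int ((hζ.continuous.pow _).mul (continuous_finsetSum _ fun i _ =>
        (hdd i j).pow 2)) (cs_pow hcs (by simp)).mul_right _
  have E4 : ∫ z in slab n (r ^ 4), ζ z ^ 8 * ∑ j, dd (eb j) (LL u) z ^ 2 ≤
      C4 * ((r ^ 2)⁻¹ ^ 2 * (∫ z in slab n (r ^ 4), ζ z ^ 4 * ∑ j, dd (eb j) u z ^ 2) +
        (r ^ 2)⁻¹ * ∫ z in slab n (r ^ 4),
          ζ z ^ (4 + 2) * ∑ j, ∑ i, dd (eb i) (dd (eb j) u) z ^ 2) := by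
    rw [S1, S2, S3, Finset.mul_sum, Finset.mul_sum, ← Finset.sum_add_distrib, Finset.mul_sum]
    exact Finset.sum_le_sum fun j _ => E2 j
  have U1 := upper (p := p) (k := 2) (by simp) hζ.continuous hcs h0 h1 hx (hu.continuous.pow 2)
    (fun z => sq_nonneg (u z))
  have U2 := upper (p := p) (k := 4) (by simp) hζ.continuous hcs h0 h1 hx
    (f := fun z => ∑ j, dd (eb j) u z ^ 2) (continuous_finsetSum _ fun i _ => (hd i).pow 2)
    (fun z => Finset.sum_nonneg fun i _ => sq_nonneg _)
  have U3 := lower (p := p) (k := 8) (by simp) hζ.continuous hcs hr hε.1 hε.2 h0 hone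
    (f := fun z => ∑ j, dd (eb j) (LL u) z ^ 2) (continuous_finsetSum _ fun i _ => (hdL i).pow 2)
    (fun z => Finset.sum_nonneg fun i _ => sq_nonneg _)
  rw [slap_eq hu]
  simp only [sgrad_eq hu, sgrad_eq hLu]
  have pA : 0 ≤ ∫ z in slab n (r ^ 4), ζ z ^ 2 * u z ^ 2 :=
    integral_nonneg fun z => mul_nonneg (pow_nonneg (h0 z) _) (sq_nonneg _)
  have pB : 0 ≤ ∫ z in slab n (r ^ 4), ζ z ^ 4 * ∑ j, dd (eb j) u z ^ 2 :=
    integral_nonneg fun z => mul_nonneg (pow_nonneg (h0 z) _)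
      (Finset.sum_nonneg fun i _ => sq_nonneg _)
  simp only [show 2 + 2 = 4 from rfl, show 2 + 4 = 6 from rfl, show 4 + 2 = 6 from rfl] at E1 E3 E4
  push_cast at E3
  generalize (∫ z in slab n (r ^ 4), ζ z ^ 2 * u z ^ 2) = A at *
  generalize (∫ z in slab n (r ^ 4), ζ z ^ 4 * ∑ j, dd (eb j) u z ^ 2) = B at *
  generalize (∫ z in slab n (r ^ 4), ζ z ^ 8 * ∑ j, dd (eb j) (LL u) z ^ 2) = X at *
  generalize (∫ z in slab n (r ^ 4), ζ z ^ 6 * ∑ j, ∑ i, dd (eb i) (dd (eb j) u) z ^ 2) = Y at *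
  generalize (∫ z in slab n (r ^ 4), ζ z ^ 6 * LL u z ^ 2) = Z at *
  generalize (∫ z in heatBall n p r, u z ^ 2) = A' at *
  generalize (∫ z in heatBall n p r, ∑ j, dd (eb j) u z ^ 2) = B' at *
  generalize (∫ z in heatBall n p (ε * r), ∑ j, dd (eb j) (LL u) z ^ 2) = X' at *
  have hsr : (r ^ 2)⁻¹ * r ^ 2 = 1 := by field_simp
  generalize (r ^ 2)⁻¹ = s at *
  rw [show r ^ 6 = (r ^ 2) ^ 3 by ring]
  have hq : 0 < r ^ 2 := by positivity
  generalize r ^ 2 = q at *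
  have F1 : Y ≤ 3 * (C2 * (s ^ 2 * A + s * B)) + 72 * K * (s * B) := by linarith
  have F2 : X ≤ C4 * (s ^ 2 * B + s * (3 * (C2 * (s ^ 2 * A + s * B)) + 72 * K * (s * B))) :=
    E4.trans (by gcongr)
  have F3 : q ^ 3 * X' ≤ q ^ 3 * (C4 * (s ^ 2 * B + s * (3 * (C2 * (s ^ 2 * A + s * B))
      + 72 * K * (s * B)))) := by
    have := U3.trans F2
    gcongr
  have F4 : q ^ 3 * (C4 * (s ^ 2 * B + s * (3 * (C2 * (s ^ 2 * A + s * B))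
      + 72 * K * (s * B)))) = C4 * (3 * C2 * A + (1 + 3 * C2 + 72 * K) * (q * B)) := by
    have hs' : s = q⁻¹ := eq_inv_of_mul_eq_one_left hsr
    rw [hs']; field_simp; ring
  rw [F4] at F3
  have F5 : C4 * (3 * C2 * A + (1 + 3 * C2 + 72 * K) * (q * B)) ≤
      C4 * ((1 + 3 * C2 + 72 * K) * A' + (1 + 3 * C2 + 72 * K) * (q * B')) := by
    have : 3 * C2 * A ≤ (1 + 3 * C2 + 72 * K) * A' := by
      apply mul_le_mul _ U1 pA (by positivity)
      linarith
    gcongr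
  have F6 : 0 ≤ A' + q * B' := by
    have : 0 ≤ q * B' := mul_nonneg hq.le (pB.trans U2)
    linarith
  linarith
end
end

section
/- Gradient-of-time-derivative estimate for bicaloric functions (Lemma 2.5, Euclidean case): For every integer n ≥ 1 and every ε ∈ (0,1) there is a constant c = c(n,ε) > 0 with the following property. Let p ∈ ℝⁿ, r > 0, and let u : ℝⁿ × ℝ → ℝ be smooth and satisfy ∂_t u + ΔΔu = 0 on ℝⁿ × [−r⁴, 0]. Then r¹⁰·∫_{Q_{εr}(p)} |∇∂_t u|² ≤ c·(∫_{Q_r(p)} u² + r²·∫_{Q_r(p)} |∇u|²). -/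
open Set Metric MeasureTheory

noncomputable section

/-- coordinate partial derivative -/
def pd {n : ℕ} (i : Fin n) (f : EuclideanSpace ℝ (Fin n) → ℝ) :
    EuclideanSpace ℝ (Fin n) → ℝ :=
  fun y => fderiv ℝ f y (EuclideanSpace.single i 1)

theorem lapE_eq {n : ℕ} (f : EuclideanSpace ℝ (Fin n) → ℝ) :
    lapE n f = fun x => ∑ i, pd i (pd i f) x := rfl

theorem pd_smooth {n : ℕ} (i : Fin n) {f : EuclideanSpace ℝ (Fin n) → ℝ}
    (hf : ContDiff ℝ (⊤ : ℕ∞) f) : ContDiff ℝ (⊤ : ℕ∞) (pd i f) :=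
  (hf.fderiv_right (m := (⊤ : ℕ∞)) (by exact le_rfl)).clm_apply contDiff_const

theorem smooth_diff {F : Type*} [NormedAddCommGroup F] [NormedSpace ℝ F] {f : F → ℝ}
    (hf : ContDiff ℝ (⊤ : ℕ∞) f) : Differentiable ℝ f :=
  hf.differentiable (by simp)

theorem lapE_smooth {n : ℕ} {f : EuclideanSpace ℝ (Fin n) → ℝ}
    (hf : ContDiff ℝ (⊤ : ℕ∞) f) : ContDiff ℝ (⊤ : ℕ∞) (lapE n f) := by
  rw [lapE_eq]
  exact ContDiff.sum fun i _ => pd_smooth i (pd_smooth i hf)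

theorem pd_mul {n : ℕ} (i : Fin n) {f g : EuclideanSpace ℝ (Fin n) → ℝ}
    (hf : ContDiff ℝ (⊤ : ℕ∞) f) (hg : ContDiff ℝ (⊤ : ℕ∞) g) :
    pd i (fun x => f x * g x) = fun x => f x * pd i g x + g x * pd i f x := by
  funext x
  simp only [pd]
  rw [fderiv_fun_mul (smooth_diff hf x) (smooth_diff hg x)]
  simp

theorem pd_add {n : ℕ} (i : Fin n) {f g : EuclideanSpace ℝ (Fin n) → ℝ}
    (hf : ContDiff ℝ (⊤ : ℕ∞) f) (hg : ContDiff ℝ (⊤ : ℕ∞) g) :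
    pd i (fun x => f x + g x) = fun x => pd i f x + pd i g x := by
  funext x
  simp only [pd]
  rw [fderiv_fun_add (smooth_diff hf x) (smooth_diff hg x)]
  simp

theorem lapE_mul {n : ℕ} {f g : EuclideanSpace ℝ (Fin n) → ℝ}
    (hf : ContDiff ℝ (⊤ : ℕ∞) f) (hg : ContDiff ℝ (⊤ : ℕ∞) g) (x : EuclideanSpace ℝ (Fin n)) :
    lapE n (fun x => f x * g x) x =
      f x * lapE n g x + 2 * ∑ i, pd i f x * pd i g x + g x * lapE n f x := by
  rw [lapE_eq, lapE_eq, lapE_eq]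
  simp only [Finset.mul_sum, ← Finset.sum_add_distrib]
  refine Finset.sum_congr rfl fun i _ => ?_
  rw [pd_mul i hf hg, pd_add i (hf.mul (pd_smooth i hg)) (hg.mul (pd_smooth i hf)),
    pd_mul i hf (pd_smooth i hg), pd_mul i hg (pd_smooth i hf)]
  ring

theorem pd_supp {n : ℕ} (i : Fin n) {f : EuclideanSpace ℝ (Fin n) → ℝ}
    (hc : HasCompactSupport f) : HasCompactSupport (pd i f) :=
  hc.fderiv_apply (𝕜 := ℝ) _

theorem lapE_supp {n : ℕ} {f : EuclideanSpace ℝ (Fin n) → ℝ}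
    (hc : HasCompactSupport f) : HasCompactSupport (lapE n f) := by
  refine HasCompactSupport.intro hc fun x hx => ?_
  rw [lapE_eq]
  refine Finset.sum_eq_zero fun i _ => ?_
  by_contra h
  have h1 : x ∈ tsupport (pd i (pd i f)) := subset_tsupport _ h
  exact hx (tsupport_fderiv_apply_subset ℝ _ (tsupport_fderiv_apply_subset ℝ _ h1))

theorem ibp {n : ℕ} (i : Fin n) {f g : EuclideanSpace ℝ (Fin n) → ℝ}
    (hf : ContDiff ℝ (⊤ : ℕ∞) f) (hg : ContDiff ℝ (⊤ : ℕ∞) g) (hc : HasCompactSupport g) :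
    ∫ x, g x * pd i f x = - ∫ x, pd i g x * f x := by
  refine integral_mul_fderiv_eq_neg_fderiv_mul_of_integrable ?_ ?_ ?_
    (fun x _ => smooth_diff hg x) (fun x _ => smooth_diff hf x)
  · exact ((pd_smooth i hg).continuous.mul hf.continuous).integrable_of_hasCompactSupport
      ((pd_supp i hc).mul_right)
  · exact (hg.continuous.mul (pd_smooth i hf).continuous).integrable_of_hasCompactSupport
      (hc.mul_right)
  · exact (hg.continuous.mul hf.continuous).integrable_of_hasCompactSupport
      (hc.mul_right)

theorem ibp' {n : ℕ} (i : Fin n) {f g : EuclideanSpace ℝ (Fin n) → ℝ}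
    (hf : ContDiff ℝ (⊤ : ℕ∞) f) (hg : ContDiff ℝ (⊤ : ℕ∞) g) (hc : HasCompactSupport g) :
    ∫ x, g x * pd i (pd i f) x = ∫ x, pd i (pd i g) x * f x := by
  rw [ibp i (pd_smooth i hf) hg hc, ibp i hf (pd_smooth i hg) (pd_supp i hc), neg_neg]

theorem green {n : ℕ} {f g : EuclideanSpace ℝ (Fin n) → ℝ}
    (hf : ContDiff ℝ (⊤ : ℕ∞) f) (hg : ContDiff ℝ (⊤ : ℕ∞) g) (hc : HasCompactSupport g) :
    ∫ x, g x * lapE n f x = ∫ x, lapE n g x * f x := by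
  rw [lapE_eq, lapE_eq]
  simp only [Finset.mul_sum, Finset.sum_mul]
  rw [integral_finsetSum, integral_finsetSum]
  · exact Finset.sum_congr rfl fun i _ => ibp' i hf hg hc
  · intro i _
    exact ((pd_smooth i (pd_smooth i hg)).continuous.mul
      hf.continuous).integrable_of_hasCompactSupport ((pd_supp i (pd_supp i hc)).mul_right)
  · intro i _
    exact (hg.continuous.mul
      (pd_smooth i (pd_smooth i hf)).continuous).integrable_of_hasCompactSupport (hc.mul_right)

theorem amgm {X A B : ℝ} (hA : 0 ≤ A) (hB : 0 ≤ B) (h : X ^ 2 ≤ 4 * A * B) : -(A + B) ≤ X := by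
  have : |X| ≤ A + B := abs_le_of_sq_le_sq (by nlinarith [sq_nonneg (A - B)]) (by positivity)
  exact (abs_le.1 this).1

theorem alg_ineq {a L g s G psi f K : ℝ} (ha : 0 ≤ a) (hG : 0 ≤ G) (hpsi : 0 ≤ psi) (hK : 0 ≤ K)
    (h1 : s ^ 2 ≤ a * psi * G) (h2 : psi ^ 2 ≤ K * a) (h3 : g ^ 2 ≤ K * a) :
    a * L ^ 2 / 4 - 2 * psi * (2 * f * L + 2 * G) - 17 * K * f ^ 2 ≤
      (a * L + 2 * s + f * g) * L := by
  have e1 : -(a * L ^ 2 / 4 + 4 * psi * G) ≤ 2 * s * L := by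
    refine amgm (by positivity) (by positivity) ?_
    have := mul_le_mul_of_nonneg_right h1 (sq_nonneg L)
    nlinarith
  have e2 : -(a * L ^ 2 / 4 + K * f ^ 2) ≤ f * g * L := by
    refine amgm (by positivity) (by positivity) ?_
    have := mul_le_mul_of_nonneg_right h3 (sq_nonneg (f * L))
    nlinarith
  have e3 : -(a * L ^ 2 / 4 + 16 * K * f ^ 2) ≤ 4 * psi * f * L := by
    refine amgm (by positivity) (by positivity) ?_
    have := mul_le_mul_of_nonneg_right h2 (sq_nonneg (f * L))
    nlinarith
  nlinarith

/-- Admissible pairs of cutoff functions. -/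
structure Cut (n : ℕ) (φ ψ : EuclideanSpace ℝ (Fin n) → ℝ) (p : EuclideanSpace ℝ (Fin n))
    (R K : ℝ) : Prop where
  sm1 : ContDiff ℝ (⊤ : ℕ∞) φ
  sm2 : ContDiff ℝ (⊤ : ℕ∞) ψ
  nn1 : ∀ x, 0 ≤ φ x
  nn2 : ∀ x, 0 ≤ ψ x
  le1 : ∀ x, φ x ≤ 1
  grad : ∀ x, ∑ i, (pd i φ x) ^ 2 ≤ φ x * ψ x
  b1 : ∀ x, (ψ x) ^ 2 ≤ K * φ x
  b2 : ∀ x, (lapE n φ x) ^ 2 ≤ K * φ x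
  b3 : ∀ x, |lapE n ψ x| ≤ K
  z1 : ∀ x ∉ ball p R, φ x = 0
  z2 : ∀ x ∉ ball p R, lapE n ψ x = 0

theorem Cut.psi0 {n : ℕ} {φ ψ : EuclideanSpace ℝ (Fin n) → ℝ} {p : EuclideanSpace ℝ (Fin n)}
    {R K : ℝ} (h : Cut n φ ψ p R K) {x : EuclideanSpace ℝ (Fin n)} (hx : φ x = 0) : ψ x = 0 := by
  have := h.b1 x
  rw [hx, mul_zero] at this
  nlinarith

theorem Cut.supp1 {n : ℕ} {φ ψ : EuclideanSpace ℝ (Fin n) → ℝ} {p : EuclideanSpace ℝ (Fin n)}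
    {R K : ℝ} (h : Cut n φ ψ p R K) : HasCompactSupport φ :=
  HasCompactSupport.intro (isCompact_closedBall p R)
    fun x hx => h.z1 x fun hx' => hx (ball_subset_closedBall hx')

theorem Cut.supp2 {n : ℕ} {φ ψ : EuclideanSpace ℝ (Fin n) → ℝ} {p : EuclideanSpace ℝ (Fin n)}
    {R K : ℝ} (h : Cut n φ ψ p R K) : HasCompactSupport ψ :=
  HasCompactSupport.intro (isCompact_closedBall p R)
    fun x hx => h.psi0 (h.z1 x fun hx' => hx (ball_subset_closedBall hx'))

theorem Cut.pointwise {n : ℕ} {φ ψ : EuclideanSpace ℝ (Fin n) → ℝ} {p : EuclideanSpace ℝ (Fin n)}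
    {R K : ℝ} (h : Cut n φ ψ p R K) (hK : 0 ≤ K) {f : EuclideanSpace ℝ (Fin n) → ℝ}
    (hf : ContDiff ℝ (⊤ : ℕ∞) f) (x : EuclideanSpace ℝ (Fin n)) :
    φ x * (lapE n f x) ^ 2 / 4 - 2 * (ψ x * lapE n (fun y => f y * f y) x)
      - 17 * K * (ball p R).indicator (fun y => (f y) ^ 2) x ≤
    lapE n (fun y => φ y * f y) x * lapE n f x := by
  rw [lapE_mul h.sm1 hf, lapE_mul hf hf]
  have hG : (0:ℝ) ≤ ∑ i, pd i f x * pd i f x :=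
    Finset.sum_nonneg fun i _ => mul_self_nonneg _
  have hs : (∑ i, pd i φ x * pd i f x) ^ 2 ≤ φ x * ψ x * ∑ i, pd i f x * pd i f x := by
    refine (Finset.sum_mul_sq_le_sq_mul_sq _ _ _).trans ?_
    simp only [sq (pd _ f x)]
    exact mul_le_mul_of_nonneg_right (h.grad x) hG
  by_cases hx : x ∈ ball p R
  · rw [indicator_of_mem hx]
    have := alg_ineq (L := lapE n f x) (f := f x) (h.nn1 x) hG (h.nn2 x) hK hs (h.b1 x) (h.b2 x)
    linarith
  · rw [indicator_of_notMem hx]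
    have := alg_ineq (L := lapE n f x) (f := f x) (K := 0) (h.nn1 x) hG (h.nn2 x) le_rfl hs
      (by rw [h.psi0 (h.z1 x hx)]; simp)
      (by have := h.b2 x; rw [h.z1 x hx, mul_zero] at this; simpa using this)
    linarith

theorem Cut.slice {n : ℕ} {φ ψ : EuclideanSpace ℝ (Fin n) → ℝ} {p : EuclideanSpace ℝ (Fin n)}
    {R K : ℝ} (h : Cut n φ ψ p R K) (hK : 0 ≤ K) {f : EuclideanSpace ℝ (Fin n) → ℝ}
    (hf : ContDiff ℝ (⊤ : ℕ∞) f) :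
    (∫ x, φ x * (lapE n f x) ^ 2) / 4 - 19 * K * ∫ x in ball p R, (f x) ^ 2 ≤
      ∫ x, φ x * (f x * lapE n (lapE n f) x) := by
  have hL := lapE_smooth hf
  have hφf : ContDiff ℝ (⊤ : ℕ∞) (fun y => φ y * f y) := h.sm1.mul hf
  have hff : ContDiff ℝ (⊤ : ℕ∞) (fun y => f y * f y) := hf.mul hf
  have g1 : ∫ x, φ x * (f x * lapE n (lapE n f) x) =
      ∫ x, lapE n (fun y => φ y * f y) x * lapE n f x := by
    rw [← green hL hφf h.supp1.mul_right]
    simp only [mul_assoc]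
  have g2 : ∫ x, ψ x * lapE n (fun y => f y * f y) x = ∫ x, lapE n ψ x * (f x * f x) :=
    green hff h.sm2 h.supp2
  have i0 : IntegrableOn (fun x => (f x) ^ 2) (ball p R) :=
    ((hf.continuous.pow 2).continuousOn.integrableOn_compact
      (isCompact_closedBall p R)).mono_set ball_subset_closedBall
  have i1 : Integrable (fun x => φ x * (lapE n f x) ^ 2 / 4) := by
    refine Integrable.div_const ?_ _
    exact (h.sm1.continuous.mul (hL.continuous.pow 2)).integrable_of_hasCompactSupport
      h.supp1.mul_right
  have i2 : Integrable (fun x => 2 * (ψ x * lapE n (fun y => f y * f y) x)) := by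
    refine Integrable.const_mul ?_ _
    exact (h.sm2.continuous.mul (lapE_smooth hff).continuous).integrable_of_hasCompactSupport
      h.supp2.mul_right
  have i3 : Integrable (fun x => 17 * K * (ball p R).indicator (fun y => (f y) ^ 2) x) := by
    refine Integrable.const_mul ?_ _
    exact (integrable_indicator_iff measurableSet_ball).2 i0
  have i4 : Integrable (fun x => lapE n (fun y => φ y * f y) x * lapE n f x) :=
    ((lapE_smooth hφf).continuous.mul hL.continuous).integrable_of_hasCompactSupport
      (lapE_supp h.supp1.mul_right).mul_right
  have key := integral_mono ((i1.sub i2).sub i3) i4 (fun x => h.pointwise hK hf x)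
  have key2 : ∫ x, lapE n ψ x * (f x * f x) ≤ K * ∫ x in ball p R, (f x) ^ 2 := by
    rw [← integral_indicator measurableSet_ball, ← integral_const_mul]
    refine integral_mono ?_ ?_ ?_
    · exact ((lapE_smooth h.sm2).continuous.mul hff.continuous).integrable_of_hasCompactSupport
        (lapE_supp h.supp2).mul_right
    · exact ((integrable_indicator_iff measurableSet_ball).2 i0).const_mul _
    · intro x
      by_cases hx : x ∈ ball p R
      · simp only [indicator_of_mem hx]
        nlinarith [(abs_le.1 (h.b3 x)).2, mul_self_nonneg (f x)]
      · simp only [indicator_of_notMem hx, h.z2 x hx]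
        simp
  rw [g1]
  rw [integral_sub' (i1.sub i2) i3, integral_sub' i1 i2, integral_div, integral_const_mul,
      integral_const_mul, g2, integral_indicator measurableSet_ball] at key
  linarith

theorem pd_scale {n : ℕ} (i : Fin n) {f : EuclideanSpace ℝ (Fin n) → ℝ}
    (hf : ContDiff ℝ (⊤ : ℕ∞) f) (p : EuclideanSpace ℝ (Fin n)) (a c : ℝ) :
    pd i (fun x => c * f (a • (x - p))) = fun x => (c * a) * pd i f (a • (x - p)) := by
  funext x
  have h1 : HasFDerivAt (fun x : EuclideanSpace ℝ (Fin n) => a • (x - p))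
      (a • ContinuousLinearMap.id ℝ (EuclideanSpace ℝ (Fin n))) x :=
    ((hasFDerivAt_id x).sub_const p).const_smul a
  have h2 := ((smooth_diff hf (a • (x - p))).hasFDerivAt.comp x h1).const_mul c
  simp only [pd]
  erw [h2.fderiv]
  simp
  ring

theorem smooth_scale {n : ℕ} {f : EuclideanSpace ℝ (Fin n) → ℝ}
    (hf : ContDiff ℝ (⊤ : ℕ∞) f) (p : EuclideanSpace ℝ (Fin n)) (a c : ℝ) :
    ContDiff ℝ (⊤ : ℕ∞) (fun x => c * f (a • (x - p))) :=
  contDiff_const.mul (hf.comp (by fun_prop : ContDiff ℝ (⊤ : ℕ∞)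
    (fun x : EuclideanSpace ℝ (Fin n) => a • (x - p))))

theorem lapE_scale {n : ℕ} {f : EuclideanSpace ℝ (Fin n) → ℝ}
    (hf : ContDiff ℝ (⊤ : ℕ∞) f) (p : EuclideanSpace ℝ (Fin n)) (a c : ℝ)
    (x : EuclideanSpace ℝ (Fin n)) :
    lapE n (fun x => c * f (a • (x - p))) x = (c * a * a) * lapE n f (a • (x - p)) := by
  rw [lapE_eq, lapE_eq]
  simp only [Finset.mul_sum]
  refine Finset.sum_congr rfl fun i _ => ?_
  rw [pd_scale i hf, pd_scale i (pd_smooth i hf)]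

theorem Cut.scale {n : ℕ} {φ ψ : EuclideanSpace ℝ (Fin n) → ℝ} {R K : ℝ}
    (h : Cut n φ ψ 0 R K) (p : EuclideanSpace ℝ (Fin n)) {r : ℝ} (hr : 0 < r) :
    Cut n (fun x => 1 * φ (r⁻¹ • (x - p))) (fun x => (r⁻¹) ^ 2 * ψ (r⁻¹ • (x - p))) p (R * r)
      (K * (r⁻¹) ^ 4) := by
  have hb : ∀ x, x ∉ ball p (R * r) → r⁻¹ • (x - p) ∉ ball (0 : EuclideanSpace ℝ (Fin n)) R := by
    intro x hx hx'
    apply hx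
    rw [mem_ball_zero_iff, norm_smul, norm_inv, Real.norm_of_nonneg hr.le, inv_mul_lt_iff₀ hr] at hx'
    rw [mem_ball_iff_norm]
    linarith
  have ha : 0 < r⁻¹ := inv_pos.2 hr
  generalize r⁻¹ = a at *
  refine ⟨smooth_scale h.sm1 _ _ _, smooth_scale h.sm2 _ _ _, ?_, ?_, ?_, ?_, ?_, ?_, ?_, ?_, ?_⟩
  · intro x; simpa using h.nn1 _
  · intro x; exact mul_nonneg (by positivity) (h.nn2 _)
  · intro x; simpa using h.le1 _
  · intro x
    simp only [pd_scale _ h.sm1, mul_pow, ← Finset.mul_sum]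
    have := mul_le_mul_of_nonneg_left (h.grad (a • (x - p))) (sq_nonneg a)
    linarith
  · intro x
    have := mul_le_mul_of_nonneg_left (h.b1 (a • (x - p))) (by positivity : 0 ≤ a ^ 4)
    simp only [mul_pow]
    linarith
  · intro x
    rw [lapE_scale h.sm1]
    have := mul_le_mul_of_nonneg_left (h.b2 (a • (x - p))) (by positivity : 0 ≤ a ^ 4)
    simp only [mul_pow]
    linarith
  · intro x
    rw [lapE_scale h.sm2, abs_mul, abs_of_nonneg (by positivity)]
    have := mul_le_mul_of_nonneg_left (h.b3 (a • (x - p))) (by positivity : 0 ≤ a ^ 4)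
    linarith
  · intro x hx
    simp [h.z1 _ (hb x hx)]
  · intro x hx
    rw [lapE_scale h.sm2, h.z2 _ (hb x hx), mul_zero]

theorem bdd_of_supp {n : ℕ} {f : EuclideanSpace ℝ (Fin n) → ℝ} (hf : Continuous f)
    (hc : HasCompactSupport f) : ∃ C : ℝ, 0 ≤ C ∧ ∀ x, |f x| ≤ C := by
  obtain ⟨C, hC⟩ := hf.bounded_above_of_compact_support hc
  exact ⟨C, (norm_nonneg _).trans (hC 0), hC⟩

theorem exists_cut (n : ℕ) {ρ R : ℝ} (h0 : 0 < ρ) (h1 : ρ < R) :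
    ∃ K : ℝ, 0 ≤ K ∧ ∃ φ ψ : EuclideanSpace ℝ (Fin n) → ℝ, Cut n φ ψ 0 R K ∧
      ∀ x ∈ ball (0 : EuclideanSpace ℝ (Fin n)) ρ, φ x = 1 := by
  let b : ContDiffBump (0 : EuclideanSpace ℝ (Fin n)) := ⟨ρ, (ρ + R) / 2, h0, by linarith⟩
  obtain ⟨η, hη⟩ : ∃ η : EuclideanSpace ℝ (Fin n) → ℝ, η = b := ⟨_, rfl⟩
  have sm : ContDiff ℝ (⊤ : ℕ∞) η := hη ▸ b.contDiff
  have nn : ∀ x, 0 ≤ η x := fun x => hη ▸ b.nonneg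
  have l1 : ∀ x, η x ≤ 1 := fun x => hη ▸ b.le_one
  have e1 : ∀ x ∈ ball (0 : EuclideanSpace ℝ (Fin n)) ρ, η x = 1 :=
    fun x hx => hη ▸ b.one_of_mem_closedBall (ball_subset_closedBall hx)
  have cs : HasCompactSupport η := hη ▸ b.hasCompactSupport
  have z : ∀ x ∉ ball (0 : EuclideanSpace ℝ (Fin n)) ((ρ + R) / 2), η x = 0 := by
    intro x hx
    rw [hη]
    exact b.zero_of_le_dist (by simpa using hx)
  let S : EuclideanSpace ℝ (Fin n) → ℝ := fun x => ∑ i, pd i η x * pd i η x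
  have hS : ContDiff ℝ (⊤ : ℕ∞) S :=
    ContDiff.sum fun i _ => (pd_smooth i sm).mul (pd_smooth i sm)
  have S0 : ∀ x, 0 ≤ S x := fun x => Finset.sum_nonneg fun i _ => mul_self_nonneg _
  let η2 : EuclideanSpace ℝ (Fin n) → ℝ := fun x => η x * η x
  have sm2 : ContDiff ℝ (⊤ : ℕ∞) η2 := sm.mul sm
  let φ : EuclideanSpace ℝ (Fin n) → ℝ := fun x => η2 x * η2 x
  have smφ : ContDiff ℝ (⊤ : ℕ∞) φ := sm2.mul sm2
  let ψ : EuclideanSpace ℝ (Fin n) → ℝ := fun x => η2 x * (16 * S x)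
  have smψ : ContDiff ℝ (⊤ : ℕ∞) ψ := sm2.mul (contDiff_const.mul hS)
  have csψ : HasCompactSupport ψ := (cs.mul_right (f' := η)).mul_right
  have pd2 : ∀ i x, pd i η2 x = 2 * η x * pd i η x := by
    intro i x
    simp only [η2]
    rw [pd_mul i sm sm]
    ring
  have pd4 : ∀ i x, pd i φ x = 4 * η x ^ 3 * pd i η x := by
    intro i x
    simp only [φ]
    rw [pd_mul i sm2 sm2]
    simp only [pd2, η2]
    ring
  have lap2 : ∀ x, lapE n η2 x = 2 * η x * lapE n η x + 2 * S x := by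
    intro x
    simp only [η2]
    rw [lapE_mul sm sm]
    simp only [S]
    ring
  have sum2 : ∀ x, ∑ i, pd i η2 x * pd i η2 x = 4 * η x ^ 2 * S x := by
    intro x
    simp only [pd2, S, Finset.mul_sum]
    refine Finset.sum_congr rfl fun i _ => ?_
    ring
  have lap4 : ∀ x, lapE n φ x = η2 x * (4 * (η x * lapE n η x) + 12 * S x) := by
    intro x
    simp only [φ]
    rw [lapE_mul sm2 sm2, sum2, lap2]
    simp only [η2]
    ring
  have csη2 : HasCompactSupport η2 := cs.mul_right
  obtain ⟨A, hA0, hA⟩ := bdd_of_supp (f := fun x => 16 * S x)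
    (continuous_const.mul hS.continuous) (by
      refine HasCompactSupport.intro cs fun x hx => ?_
      simp only [S, mul_eq_zero]
      right
      refine Finset.sum_eq_zero fun i _ => ?_
      have : pd i η x = 0 := by
        by_contra h
        exact hx (tsupport_fderiv_apply_subset ℝ _ (subset_tsupport _ h))
      simp [this])
  obtain ⟨B, hB0, hB⟩ := bdd_of_supp (f := fun x => η x * lapE n η x)
    (sm.continuous.mul (lapE_smooth sm).continuous) cs.mul_right
  obtain ⟨D, hD0, hD⟩ := bdd_of_supp (lapE_smooth smψ).continuous (lapE_supp csψ)
  refine ⟨A ^ 2 + (4 * B + A) ^ 2 + D, by positivity, φ, ψ, ⟨smφ, smψ, ?_, ?_, ?_, ?_, ?_, ?_,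
    ?_, ?_, ?_⟩, ?_⟩
  · intro x; exact mul_self_nonneg _
  · intro x; exact mul_nonneg (mul_self_nonneg _) (by linarith [S0 x])
  · intro x
    have : η2 x ≤ 1 := mul_le_one₀ (l1 x) (nn x) (l1 x)
    exact mul_le_one₀ this (mul_self_nonneg _) this
  · intro x
    apply le_of_eq
    simp only [pd4, φ, ψ, S, η2, Finset.mul_sum]
    refine Finset.sum_congr rfl fun i _ => ?_
    ring
  · intro x
    have h1 : (16 * S x) ^ 2 ≤ A ^ 2 := sq_le_sq' (by linarith [S0 x]) ((le_abs_self _).trans (hA x))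
    have h2 : 0 ≤ φ x := mul_self_nonneg _
    have h3 : ψ x ^ 2 = (16 * S x) ^ 2 * φ x := by simp only [ψ, φ]; ring
    rw [h3]
    refine mul_le_mul_of_nonneg_right ?_ h2
    nlinarith [sq_nonneg (4 * B + A)]
  · intro x
    have hAx := (le_abs_self _).trans (hA x)
    have hBx := abs_le.1 (hB x)
    have h1 : (4 * (η x * lapE n η x) + 12 * S x) ^ 2 ≤ (4 * B + A) ^ 2 :=
      sq_le_sq' (by linarith [S0 x]) (by linarith [S0 x])
    have h2 : 0 ≤ φ x := mul_self_nonneg _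
    have h3 : lapE n φ x ^ 2 = (4 * (η x * lapE n η x) + 12 * S x) ^ 2 * φ x := by
      rw [lap4]; simp only [φ]; ring
    rw [h3]
    refine mul_le_mul_of_nonneg_right ?_ h2
    nlinarith [sq_nonneg A]
  · intro x
    exact (hD x).trans (by nlinarith [sq_nonneg A, sq_nonneg (4 * B + A)])
  · intro x hx
    have : η x = 0 := z x fun h => hx (ball_subset_ball (by linarith) h)
    simp [φ, η2, this]
  · intro x hx
    have ht : tsupport ψ ⊆ closedBall 0 ((ρ + R) / 2) := by
      refine closure_minimal ?_ isClosed_closedBall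
      intro y hy
      by_contra h
      apply hy
      have : η y = 0 := z y fun h' => h (ball_subset_closedBall h')
      simp [ψ, η2, this]
    rw [lapE_eq]
    refine Finset.sum_eq_zero fun i _ => ?_
    by_contra h
    have h1 : x ∈ tsupport (pd i (pd i ψ)) := subset_tsupport _ h
    have h2 := ht (tsupport_fderiv_apply_subset ℝ _ (tsupport_fderiv_apply_subset ℝ _ h1))
    exact hx (closedBall_subset_ball (by linarith) h2)
  · intro x hx
    simp [φ, η2, e1 x hx]

/-- directional derivative on space-time -/
def DD {n : ℕ} (v : EuclideanSpace ℝ (Fin n) × ℝ) (u : EuclideanSpace ℝ (Fin n) × ℝ → ℝ) :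
    EuclideanSpace ℝ (Fin n) × ℝ → ℝ := fun z => fderiv ℝ u z v

theorem DD_smooth {n : ℕ} (v : EuclideanSpace ℝ (Fin n) × ℝ)
    {u : EuclideanSpace ℝ (Fin n) × ℝ → ℝ} (hu : ContDiff ℝ (⊤ : ℕ∞) u) :
    ContDiff ℝ (⊤ : ℕ∞) (DD v u) :=
  (hu.fderiv_right (m := (⊤ : ℕ∞)) (by exact le_rfl)).clm_apply contDiff_const

theorem DD_comm {n : ℕ} (v w : EuclideanSpace ℝ (Fin n) × ℝ)
    {u : EuclideanSpace ℝ (Fin n) × ℝ → ℝ} (hu : ContDiff ℝ (⊤ : ℕ∞) u) :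
    DD v (DD w u) = DD w (DD v u) := by
  funext z
  have hd : DifferentiableAt ℝ (fderiv ℝ u) z :=
    (hu.fderiv_right (m := (⊤ : ℕ∞)) (by exact le_rfl)).differentiable (by simp) z
  have hs : IsSymmSndFDerivAt ℝ u z := by
    refine hu.contDiffAt.isSymmSndFDerivAt ?_
    simp only [minSmoothness_of_isRCLikeNormedField]
    exact WithTop.coe_le_coe.2 (le_top : (2 : ℕ∞) ≤ ⊤)
  have key : ∀ a b : EuclideanSpace ℝ (Fin n) × ℝ,
      DD a (DD b u) z = fderiv ℝ (fderiv ℝ u) z a b := by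
    intro a b
    unfold DD
    rw [fderiv_clm_apply hd (differentiableAt_const b)]
    simp
  rw [key, key]
  exact hs v w

theorem DD_add {n : ℕ} (v : EuclideanSpace ℝ (Fin n) × ℝ)
    {f g : EuclideanSpace ℝ (Fin n) × ℝ → ℝ} (hf : ContDiff ℝ (⊤ : ℕ∞) f)
    (hg : ContDiff ℝ (⊤ : ℕ∞) g) :
    DD v (fun z => f z + g z) = fun z => DD v f z + DD v g z := by
  funext z
  simp only [DD]
  rw [fderiv_fun_add (smooth_diff hf z) (smooth_diff hg z)]
  simp

theorem DD_sum {n : ℕ} (v : EuclideanSpace ℝ (Fin n) × ℝ)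
    {f : Fin n → EuclideanSpace ℝ (Fin n) × ℝ → ℝ} (hf : ∀ i, ContDiff ℝ (⊤ : ℕ∞) (f i)) :
    DD v (fun z => ∑ i, f i z) = fun z => ∑ i, DD v (f i) z := by
  funext z
  simp only [DD]
  rw [fderiv_fun_sum fun i _ => smooth_diff (hf i) z]
  simp

/-- spatial direction -/
def ev {n : ℕ} (i : Fin n) : EuclideanSpace ℝ (Fin n) × ℝ := (EuclideanSpace.single i 1, 0)

theorem slice_smooth {n : ℕ} {u : EuclideanSpace ℝ (Fin n) × ℝ → ℝ}
    (hu : ContDiff ℝ (⊤ : ℕ∞) u) (t : ℝ) : ContDiff ℝ (⊤ : ℕ∞) (fun y => u (y, t)) :=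
  hu.comp (contDiff_id.prodMk contDiff_const)

theorem slice_pd {n : ℕ} (i : Fin n) {u : EuclideanSpace ℝ (Fin n) × ℝ → ℝ}
    (hu : ContDiff ℝ (⊤ : ℕ∞) u) (t : ℝ) :
    pd i (fun y => u (y, t)) = fun x => DD (ev i) u (x, t) := by
  funext x
  have h1 : HasFDerivAt (fun y : EuclideanSpace ℝ (Fin n) => (y, t))
      (ContinuousLinearMap.inl ℝ (EuclideanSpace ℝ (Fin n)) ℝ) x := hasFDerivAt_prodMk_left x t
  have h2 := (smooth_diff hu (x, t)).hasFDerivAt.comp x h1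
  simp only [pd, DD]
  erw [h2.fderiv]
  simp [ev]

theorem tderiv_eq_s4 {n : ℕ} {u : EuclideanSpace ℝ (Fin n) × ℝ → ℝ}
    (hu : ContDiff ℝ (⊤ : ℕ∞) u) : tderiv n u = DD (0, 1) u := by
  funext z
  have h1 : HasFDerivAt (fun s : ℝ => (z.1, s))
      (ContinuousLinearMap.inr ℝ (EuclideanSpace ℝ (Fin n)) ℝ) z.2 := hasFDerivAt_prodMk_right z.1 z.2
  have h2 := (smooth_diff hu (z.1, z.2)).hasFDerivAt.comp z.2 h1
  have h3 := h2.hasDerivAt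
  simp only [tderiv, DD]
  erw [h3.deriv]
  simp

theorem tderiv_hasDeriv {n : ℕ} {u : EuclideanSpace ℝ (Fin n) × ℝ → ℝ}
    (hu : ContDiff ℝ (⊤ : ℕ∞) u) (x : EuclideanSpace ℝ (Fin n)) (t : ℝ) :
    HasDerivAt (fun s => u (x, s)) (tderiv n u (x, t)) t := by
  have : Differentiable ℝ (fun s : ℝ => u (x, s)) :=
    (smooth_diff hu).comp ((differentiable_const x).prodMk differentiable_id)
  exact (this t).hasDerivAt

theorem slap_eq_s4 {n : ℕ} {u : EuclideanSpace ℝ (Fin n) × ℝ → ℝ}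
    (hu : ContDiff ℝ (⊤ : ℕ∞) u) : slap n u = fun z => ∑ i, DD (ev i) (DD (ev i) u) z := by
  funext z
  simp only [slap]
  rw [lapE_eq]
  refine Finset.sum_congr rfl fun i _ => ?_
  rw [slice_pd i hu, slice_pd i (DD_smooth _ hu)]

theorem slap_smooth {n : ℕ} {u : EuclideanSpace ℝ (Fin n) × ℝ → ℝ}
    (hu : ContDiff ℝ (⊤ : ℕ∞) u) : ContDiff ℝ (⊤ : ℕ∞) (slap n u) := by
  rw [slap_eq_s4 hu]
  exact ContDiff.sum fun i _ => DD_smooth _ (DD_smooth _ hu)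

theorem slap_DD {n : ℕ} (v : EuclideanSpace ℝ (Fin n) × ℝ)
    {u : EuclideanSpace ℝ (Fin n) × ℝ → ℝ}
    (hu : ContDiff ℝ (⊤ : ℕ∞) u) : DD v (slap n u) = slap n (DD v u) := by
  rw [slap_eq_s4 hu, slap_eq_s4 (DD_smooth v hu), DD_sum v fun i => DD_smooth _ (DD_smooth _ hu)]
  funext z
  refine Finset.sum_congr rfl fun i _ => ?_
  rw [DD_comm v (ev i) (DD_smooth _ hu), DD_comm v (ev i) hu]

theorem slap_add {n : ℕ} {f g : EuclideanSpace ℝ (Fin n) × ℝ → ℝ} (hf : ContDiff ℝ (⊤ : ℕ∞) f)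
    (hg : ContDiff ℝ (⊤ : ℕ∞) g) :
    slap n (fun z => f z + g z) = fun z => slap n f z + slap n g z := by
  rw [slap_eq_s4 (hf.add hg), slap_eq_s4 hf, slap_eq_s4 hg]
  funext z
  rw [← Finset.sum_add_distrib]
  refine Finset.sum_congr rfl fun i _ => ?_
  rw [DD_add _ hf hg, DD_add _ (DD_smooth _ hf) (DD_smooth _ hg)]

theorem bical_DD {n : ℕ} (i : Fin n) {u : EuclideanSpace ℝ (Fin n) × ℝ → ℝ} {r : ℝ}
    (hu : ContDiff ℝ (⊤ : ℕ∞) u) (hb : BicaloricOn n u r) : BicaloricOn n (DD (ev i) u) r := by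
  intro x t ht
  have hs := DD_smooth (ev i) hu
  have s1 := DD_smooth (0, 1) hu
  have s2 := slap_smooth (slap_smooth hu)
  rw [tderiv_eq_s4 hs, ← slap_DD _ hu, ← slap_DD _ (slap_smooth hu), DD_comm _ _ hu]
  have h1 := congrFun (DD_add (ev i) s1 s2) (x, t)
  rw [← h1]
  have h2 := congrFun (slice_pd i (s1.add s2) t) x
  rw [← h2]
  have h3 : (fun y => DD (0, 1) u (y, t) + slap n (slap n u) (y, t)) = fun _ => 0 := by
    funext y
    rw [← tderiv_eq_s4 hu]
    exact hb y t ht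
  rw [h3]
  simp [pd]

theorem bical_slap {n : ℕ} {u : EuclideanSpace ℝ (Fin n) × ℝ → ℝ} {r : ℝ}
    (hu : ContDiff ℝ (⊤ : ℕ∞) u) (hb : BicaloricOn n u r) : BicaloricOn n (slap n u) r := by
  intro x t ht
  have hs := slap_smooth hu
  have s1 := DD_smooth (0, 1) hu
  have s2 := slap_smooth (slap_smooth hu)
  rw [tderiv_eq_s4 hs, slap_DD _ hu]
  have h1 := congrFun (slap_add s1 s2) (x, t)
  rw [← h1]
  have h3 : (fun y => DD (0, 1) u (y, t) + slap n (slap n u) (y, t)) = fun _ => 0 := by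
    funext y
    rw [← tderiv_eq_s4 hu]
    exact hb y t ht
  simp only [slap] at h3 ⊢
  rw [h3]
  simp [lapE]

theorem sgrad_sq {n : ℕ} {u : EuclideanSpace ℝ (Fin n) × ℝ → ℝ}
    (hu : ContDiff ℝ (⊤ : ℕ∞) u) (z : EuclideanSpace ℝ (Fin n) × ℝ) :
    ‖sgrad n u z‖ ^ 2 = ∑ i, (DD (ev i) u z) ^ 2 := by
  rw [EuclideanSpace.norm_sq_eq]
  refine Finset.sum_congr rfl fun i _ => ?_
  have h := congrFun (slice_pd i hu z.2) z.1
  have h2 : sgrad n u z i = DD (ev i) u z := by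
    rw [← (show DD (ev i) u (z.1, z.2) = DD (ev i) u z from rfl), ← h]
    simp only [pd, sgrad, gradient]
    rw [← InnerProductSpace.toDual_symm_apply (𝕜 := ℝ), real_inner_comm,
      EuclideanSpace.inner_single_left]
    simp
  rw [h2, Real.norm_eq_abs, sq_abs]

theorem q_int {n : ℕ} {h : EuclideanSpace ℝ (Fin n) × ℝ → ℝ} (hh : Continuous h)
    (p : EuclideanSpace ℝ (Fin n)) (R : ℝ) : IntegrableOn h (heatBall n p R) :=
  (hh.continuousOn.integrableOn_compact
    ((isCompact_closedBall p R).prod isCompact_Icc)).mono_set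
    (prod_mono ball_subset_closedBall le_rfl)

theorem q_int' {n : ℕ} {h : EuclideanSpace ℝ (Fin n) × ℝ → ℝ} (hh : Continuous h)
    (p : EuclideanSpace ℝ (Fin n)) (R : ℝ) :
    Integrable h ((volume.restrict (ball p R)).prod (volume.restrict (Icc (-(R ^ 4)) 0))) := by
  rw [Measure.prod_restrict]
  exact q_int hh p R

theorem q_fub {n : ℕ} {h : EuclideanSpace ℝ (Fin n) × ℝ → ℝ} (hh : Continuous h)
    (p : EuclideanSpace ℝ (Fin n)) (R : ℝ) :
    ∫ z in heatBall n p R, h z = ∫ t in Icc (-(R ^ 4)) 0, ∫ x in ball p R, h (x, t) := by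
  rw [← integral_prod_symm _ (q_int' hh p R), Measure.prod_restrict]
  rfl

theorem cut_int {n : ℕ} {φ : EuclideanSpace ℝ (Fin n) → ℝ} (hφ : Continuous φ)
    (hc : HasCompactSupport φ) {h : EuclideanSpace ℝ (Fin n) × ℝ → ℝ} (hh : Continuous h)
    (a b : ℝ) : Integrable (fun z : EuclideanSpace ℝ (Fin n) × ℝ => φ z.1 * h z)
      ((volume : Measure (EuclideanSpace ℝ (Fin n))).prod (volume.restrict (Icc a b))) := by
  have h1 : (volume : Measure (EuclideanSpace ℝ (Fin n))).prod (volume.restrict (Icc a b)) =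
      (volume : Measure (EuclideanSpace ℝ (Fin n) × ℝ)).restrict (univ ×ˢ Icc a b) := by
    rw [Measure.volume_eq_prod, ← Measure.prod_restrict, Measure.restrict_univ]
  rw [h1]
  change IntegrableOn _ _ _
  have hcont : Continuous (fun z : EuclideanSpace ℝ (Fin n) × ℝ => φ z.1 * h z) :=
    (hφ.comp continuous_fst).mul hh
  refine (hcont.continuousOn.integrableOn_compact (hc.prod isCompact_Icc)
    (K := tsupport φ ×ˢ Icc a b)).of_forall_sdiff_eq_zero (MeasurableSet.univ.prod measurableSet_Icc) ?_
  rintro ⟨x, t⟩ ⟨⟨_, ht⟩, h2⟩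
  have : x ∉ tsupport φ := fun hx => h2 ⟨hx, ht⟩
  simp [image_eq_zero_of_notMem_tsupport this]

theorem ftc_nonneg {n : ℕ} {w : EuclideanSpace ℝ (Fin n) × ℝ → ℝ}
    (hw : ContDiff ℝ (⊤ : ℕ∞) w) (x : EuclideanSpace ℝ (Fin n)) {A : ℝ} (hA : 0 ≤ A) :
    0 ≤ ∫ t in Icc (-A) 0, ((w (x, t)) ^ 2 + 2 * (t + A) * (w (x, t) * tderiv n w (x, t))) := by
  have hwc : Continuous fun t : ℝ => w (x, t) := hw.continuous.comp (by fun_prop)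
  have htc : Continuous fun t : ℝ => tderiv n w (x, t) := by
    rw [tderiv_eq_s4 hw]
    exact (DD_smooth _ hw).continuous.comp (by fun_prop)
  rw [integral_Icc_eq_integral_Ioc, ← intervalIntegral.integral_of_le (by linarith)]
  rw [intervalIntegral.integral_eq_sub_of_hasDerivAt (f := fun t => (t + A) * (w (x, t)) ^ 2)]
  · simp
    positivity
  · intro t _
    have h1 := ((hasDerivAt_id t).add_const A).mul ((tderiv_hasDeriv hw x t).pow 2)
    refine h1.congr_deriv ?_
    simp only [id, Pi.pow_apply]
    push_cast
    ring
  · apply Continuous.intervalIntegrable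
    fun_prop

theorem caccio {n : ℕ} {φ ψ : EuclideanSpace ℝ (Fin n) → ℝ} {p : EuclideanSpace ℝ (Fin n)}
    {τ T K : ℝ} (h : Cut n φ ψ p T K) (hK : 0 ≤ K) (hτ : 0 < τ) (hT : τ < T)
    (hone : ∀ x ∈ ball p τ, φ x = 1)
    {w : EuclideanSpace ℝ (Fin n) × ℝ → ℝ} (hw : ContDiff ℝ (⊤ : ℕ∞) w)
    (hb : BicaloricOn n w T) :
    (T ^ 4 - τ ^ 4) / 2 * (∫ z in heatBall n p τ, (slap n w z) ^ 2) ≤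
      (1 + 38 * K * T ^ 4) * ∫ z in heatBall n p T, (w z) ^ 2 := by
  have hLs := slap_smooth hw
  have hττ : τ ^ 4 ≤ T ^ 4 := pow_le_pow_left₀ hτ.le hT.le 4
  have hT4 : 0 ≤ T ^ 4 := by positivity
  have hτ4 : 0 ≤ τ ^ 4 := by positivity
  have htc : Continuous (tderiv n w) := by
    rw [tderiv_eq_s4 hw]; exact (DD_smooth _ hw).continuous
  have hwc := hw.continuous
  have hint : Integrable (fun z : EuclideanSpace ℝ (Fin n) × ℝ =>
      φ z.1 * ((w z) ^ 2 + 2 * (z.2 + T ^ 4) * (w z * tderiv n w z)))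
      ((volume : Measure (EuclideanSpace ℝ (Fin n))).prod
        (volume.restrict (Icc (-(T ^ 4)) 0))) :=
    cut_int h.sm1.continuous h.supp1 (by fun_prop) _ _
  have hpos : 0 ≤ ∫ t in Icc (-(T ^ 4)) 0, ∫ x,
      φ x * ((w (x, t)) ^ 2 + 2 * (t + T ^ 4) * (w (x, t) * tderiv n w (x, t))) := by
    rw [← integral_prod_symm _ hint, integral_prod _ hint]
    refine integral_nonneg fun x => ?_
    simp only [integral_const_mul]
    exact mul_nonneg (h.nn1 x) (ftc_nonneg hw x hT4)
  have hG : Integrable (fun t => ∫ x in ball p T, (w (x, t)) ^ 2)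
      (volume.restrict (Icc (-(T ^ 4)) 0)) :=
    (q_int' (hwc.pow 2) p T).integral_prod_right
  have hg : Integrable (fun t => ∫ x in ball p τ, (slap n w (x, t)) ^ 2)
      (volume.restrict (Icc (-(τ ^ 4)) 0)) :=
    (q_int' (hLs.continuous.pow 2) p τ).integral_prod_right
  have hsub : Icc (-(τ ^ 4)) (0 : ℝ) ⊆ Icc (-(T ^ 4)) 0 := Icc_subset_Icc (by linarith) le_rfl
  have hg' : Integrable ((Icc (-(τ ^ 4)) (0 : ℝ)).indicator
      (fun t => ∫ x in ball p τ, (slap n w (x, t)) ^ 2))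
      (volume.restrict (Icc (-(T ^ 4)) 0)) :=
    ((integrable_indicator_iff measurableSet_Icc).2 hg).restrict
  have hle : ∀ t ∈ Icc (-(T ^ 4)) (0 : ℝ), (∫ x,
      φ x * ((w (x, t)) ^ 2 + 2 * (t + T ^ 4) * (w (x, t) * tderiv n w (x, t)))) ≤
      (1 + 38 * K * T ^ 4) * (∫ x in ball p T, (w (x, t)) ^ 2) -
      (T ^ 4 - τ ^ 4) / 2 * (Icc (-(τ ^ 4)) (0 : ℝ)).indicator
        (fun t => ∫ x in ball p τ, (slap n w (x, t)) ^ 2) t := by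
    intro t ht
    have hf := slice_smooth hw t
    have hfc := hf.continuous
    have hL := lapE_smooth hf
    have sl := h.slice hK hf
    have hLL : ∀ x, tderiv n w (x, t) = - lapE n (lapE n (fun y => w (y, t))) x := by
      intro x
      have := hb x t ht
      simp only [slap] at this
      change _ + lapE n (lapE n (fun y => w (y, t))) x = 0 at this
      linarith
    have i1 : Integrable (fun x => φ x * (w (x, t)) ^ 2) :=
      (h.sm1.continuous.mul (hfc.pow 2)).integrable_of_hasCompactSupport h.supp1.mul_right
    have i2 : Integrable (fun x => φ x * (w (x, t) * lapE n (lapE n (fun y => w (y, t))) x)) :=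
      (h.sm1.continuous.mul (hfc.mul (lapE_smooth hL).continuous)).integrable_of_hasCompactSupport
        h.supp1.mul_right
    have i3 : Integrable (fun x => φ x * (lapE n (fun y => w (y, t)) x) ^ 2) :=
      (h.sm1.continuous.mul (hL.continuous.pow 2)).integrable_of_hasCompactSupport
        h.supp1.mul_right
    have i0 : IntegrableOn (fun x => (w (x, t)) ^ 2) (ball p T) :=
      ((hfc.pow 2).continuousOn.integrableOn_compact
        (isCompact_closedBall p T)).mono_set ball_subset_closedBall
    have e1 : (∫ x,
        φ x * ((w (x, t)) ^ 2 + 2 * (t + T ^ 4) * (w (x, t) * tderiv n w (x, t)))) =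
        (∫ x, φ x * (w (x, t)) ^ 2) - 2 * (t + T ^ 4) *
          ∫ x, φ x * (w (x, t) * lapE n (lapE n (fun y => w (y, t))) x) := by
      rw [← integral_const_mul, ← integral_sub i1 (i2.const_mul _)]
      refine integral_congr_ae (Filter.Eventually.of_forall fun x => ?_)
      simp only [hLL]
      ring
    have e2 : (∫ x, φ x * (w (x, t)) ^ 2) ≤ ∫ x in ball p T, (w (x, t)) ^ 2 := by
      rw [← integral_indicator measurableSet_ball]
      refine integral_mono i1 ((integrable_indicator_iff measurableSet_ball).2 i0) fun x => ?_
      by_cases hx : x ∈ ball p T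
      · simp only [indicator_of_mem hx]
        exact mul_le_of_le_one_left (sq_nonneg _) (h.le1 x)
      · simp [indicator_of_notMem hx, h.z1 x hx]
    have e3 : ∫ x in ball p τ, (slap n w (x, t)) ^ 2 ≤
        ∫ x, φ x * (lapE n (fun y => w (y, t)) x) ^ 2 := by
      have : ∫ x in ball p τ, (slap n w (x, t)) ^ 2 =
          ∫ x in ball p τ, φ x * (lapE n (fun y => w (y, t)) x) ^ 2 := by
        refine setIntegral_congr_fun measurableSet_ball fun x hx => ?_
        simp only [hone x hx, one_mul, slap]
      rw [this]
      exact setIntegral_le_integral i3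
        (Filter.Eventually.of_forall fun x => mul_nonneg (h.nn1 x) (sq_nonneg _))
    have n1 : 0 ≤ ∫ x, φ x * (lapE n (fun y => w (y, t)) x) ^ 2 :=
      integral_nonneg fun x => mul_nonneg (h.nn1 x) (sq_nonneg _)
    have n2 : 0 ≤ ∫ x in ball p T, (w (x, t)) ^ 2 := integral_nonneg fun x => sq_nonneg _
    have hχ : 0 ≤ t + T ^ 4 := by linarith [ht.1]
    have e4 : (T ^ 4 - τ ^ 4) * (Icc (-(τ ^ 4)) (0 : ℝ)).indicator
        (fun t => ∫ x in ball p τ, (slap n w (x, t)) ^ 2) t ≤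
        (t + T ^ 4) * ∫ x, φ x * (lapE n (fun y => w (y, t)) x) ^ 2 := by
      by_cases h' : t ∈ Icc (-(τ ^ 4)) (0 : ℝ)
      · rw [indicator_of_mem h']
        refine mul_le_mul (by linarith [h'.1]) e3 (integral_nonneg fun x => sq_nonneg _) hχ
      · rw [indicator_of_notMem h', mul_zero]
        exact mul_nonneg hχ n1
    rw [e1]
    have m1 := mul_le_mul_of_nonneg_left sl hχ
    have m2 : (t + T ^ 4) * (K * ∫ x in ball p T, (w (x, t)) ^ 2) ≤
        T ^ 4 * (K * ∫ x in ball p T, (w (x, t)) ^ 2) :=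
      mul_le_mul_of_nonneg_right (by linarith [ht.2]) (mul_nonneg hK n2)
    linarith
  have hmono := setIntegral_mono_on hint.integral_prod_right
    ((hG.const_mul (1 + 38 * K * T ^ 4)).sub (hg'.const_mul ((T ^ 4 - τ ^ 4) / 2)))
    measurableSet_Icc hle
  have e5 := hpos.trans hmono
  rw [integral_sub' (hG.const_mul _) (hg'.const_mul _), integral_const_mul, integral_const_mul,
    setIntegral_indicator measurableSet_Icc, inter_eq_self_of_subset_right hsub] at e5
  have q1 := q_fub (h := fun z => (slap n w z) ^ 2) (hLs.continuous.pow 2) p τ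
  have q2 := q_fub (h := fun z => (w z) ^ 2) (hwc.pow 2) p T
  rw [q1, q2]
  linarith

theorem caccio' (n : ℕ) {ρ R : ℝ} (h0 : 0 < ρ) (h1 : ρ < R) :
    ∃ C : ℝ, 0 < C ∧ ∀ (p : EuclideanSpace ℝ (Fin n)) (r : ℝ), 0 < r →
      ∀ w : EuclideanSpace ℝ (Fin n) × ℝ → ℝ, ContDiff ℝ (⊤ : ℕ∞) w →
      BicaloricOn n w (R * r) →
      r ^ 4 * (∫ z in heatBall n p (ρ * r), (slap n w z) ^ 2) ≤
        C * ∫ z in heatBall n p (R * r), (w z) ^ 2 := by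
  obtain ⟨K, hK, φ, ψ, hcut, hone⟩ := exists_cut n h0 h1
  have hd : 0 < R ^ 4 - ρ ^ 4 := sub_pos.2 (pow_lt_pow_left₀ h1 h0.le (by norm_num))
  have hR : 0 < R := h0.trans h1
  refine ⟨(1 + 38 * K * R ^ 4) / ((R ^ 4 - ρ ^ 4) / 2), by positivity, ?_⟩
  intro p r hr w hw hb
  have key := caccio (hcut.scale p hr) (by positivity) (mul_pos h0 hr)
    (mul_lt_mul_of_pos_right h1 hr) (fun x hx => by
      rw [one_mul]
      apply hone
      rw [mem_ball_iff_norm] at hx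
      rw [mem_ball_zero_iff, norm_smul, norm_inv, Real.norm_of_nonneg hr.le, inv_mul_lt_iff₀ hr]
      linarith) hw hb
  have e1 : 1 + 38 * (K * r⁻¹ ^ 4) * (R * r) ^ 4 = 1 + 38 * K * R ^ 4 := by
    field_simp
  have e2 : ((R * r) ^ 4 - (ρ * r) ^ 4) / 2 = (R ^ 4 - ρ ^ 4) / 2 * r ^ 4 := by ring
  rw [e1, e2] at key
  rw [div_mul_eq_mul_div, le_div_iff₀ (by positivity)]
  linarith

theorem BicaloricOn.mono' {n : ℕ} {u : EuclideanSpace ℝ (Fin n) × ℝ → ℝ} {r s : ℝ}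
    (h : BicaloricOn n u r) (hs : 0 ≤ s) (hsr : s ≤ r) : BicaloricOn n u s := by
  intro x t ht
  have : s ^ 4 ≤ r ^ 4 := pow_le_pow_left₀ hs hsr 4
  exact h x t ⟨by linarith [ht.1], ht.2⟩

/-- **Gradient-of-time-derivative estimate for bicaloric functions** (Lemma 2.5, Euclidean case). -/
theorem grad_time_derivative_estimate_bicaloric (n : ℕ) (hn : 1 ≤ n) (ε : ℝ)
    (hε : ε ∈ Set.Ioo (0 : ℝ) 1) :
    ∃ c : ℝ, 0 < c ∧
      ∀ (p : EuclideanSpace ℝ (Fin n)) (r : ℝ), 0 < r →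
      ∀ u : EuclideanSpace ℝ (Fin n) × ℝ → ℝ, ContDiff ℝ (⊤ : ℕ∞) u → BicaloricOn n u r →
      r ^ 10 * (∫ z in heatBall n p (ε * r), ‖sgrad n (tderiv n u) z‖ ^ 2) ≤
      c * ((∫ z in heatBall n p r, (u z) ^ 2) +
          r ^ 2 * ∫ z in heatBall n p r, ‖sgrad n u z‖ ^ 2) := by
  obtain ⟨h0, h1⟩ := hε
  obtain ⟨C1, hC1, H1⟩ := caccio' n h0 (by linarith : ε < (1 + ε) / 2)
  obtain ⟨C2, hC2, H2⟩ := caccio' n (by linarith : 0 < (1 + ε) / 2) (by linarith : (1 + ε) / 2 < 1)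
  refine ⟨C1 * C2, by positivity, ?_⟩
  intro p r hr u hu hb
  have ht : ContDiff ℝ (⊤ : ℕ∞) (tderiv n u) := by
    rw [tderiv_eq_s4 hu]; exact DD_smooth _ hu
  have key : ∀ i : Fin n, r ^ 8 * (∫ z in heatBall n p (ε * r), (DD (ev i) (tderiv n u) z) ^ 2) ≤
      C1 * C2 * ∫ z in heatBall n p r, (DD (ev i) u z) ^ 2 := by
    intro i
    have hw := DD_smooth (ev i) hu
    have hbw := bical_DD i hu hb
    have hm : (1 + ε) / 2 * r ≤ r := by nlinarith
    have hεr : ε * r ≤ r := by nlinarith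
    have a1 := H1 p r hr _ (slap_smooth hw)
      ((bical_slap hw hbw).mono' (by positivity) hm)
    have a2 := H2 p r hr _ hw (by rw [one_mul]; exact hbw)
    rw [one_mul] at a2
    have e : ∫ z in heatBall n p (ε * r), (DD (ev i) (tderiv n u) z) ^ 2 =
        ∫ z in heatBall n p (ε * r), (slap n (slap n (DD (ev i) u)) z) ^ 2 := by
      refine setIntegral_congr_fun (measurableSet_ball.prod measurableSet_Icc) ?_
      rintro ⟨x, t⟩ ⟨_, hz⟩
      have h2 := hbw.mono' (s := ε * r) (by positivity) hεr x t hz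
      have h3 : DD (ev i) (tderiv n u) = tderiv n (DD (ev i) u) := by
        rw [tderiv_eq_s4 hu, tderiv_eq_s4 hw, DD_comm _ _ hu]
      simp only [h3]
      rw [eq_neg_of_add_eq_zero_left h2, neg_sq]
    rw [e]
    have b1 := mul_le_mul_of_nonneg_left a1 (by positivity : 0 ≤ r ^ 4)
    have b2 := mul_le_mul_of_nonneg_left a2 hC1.le
    linarith
  simp only [sgrad_sq ht, sgrad_sq hu]
  rw [integral_finsetSum, integral_finsetSum]
  · have hsum := Finset.sum_le_sum fun (i : Fin n) (_ : i ∈ Finset.univ) => key i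
    rw [← Finset.mul_sum, ← Finset.mul_sum] at hsum
    have n0 : 0 ≤ ∫ z in heatBall n p r, (u z) ^ 2 := integral_nonneg fun z => sq_nonneg _
    have n1 : 0 ≤ C1 * C2 * ∫ z in heatBall n p r, (u z) ^ 2 := by positivity
    have b := mul_le_mul_of_nonneg_left hsum (sq_nonneg r)
    linarith
  · intro i _
    exact q_int ((DD_smooth _ hu).continuous.pow 2) _ _
  · intro i _
    exact q_int ((DD_smooth _ ht).continuous.pow 2) _ _
end
end
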